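/- Let n ≥ 1, and let min, max, a, b_1,…,b_n be integers with min ≤ 0 ≤ b_1 < b_2 < … < b_n ≤ max and min ≤ a ≤ max. Then Σ_M u^{inv(M)} v^{inv'(M)}, the sum over all monotone triangles M of order n with bottom row (b_1,…,b_n) and top entry m_{1,1} = a, equals the constant term in x_1,…,x_n of the Laurent polynomial [∏_{i=1}^{n} (1+x_i)^{b_i} x_i^{−n+1} · ∏_{1≤i<j≤n} (x_i − x_j)(1 + (1−v)x_i + u(x_j + x_i x_j))] × [Σ_{b=0}^{max−min} (−1)^{a+min+b} · C(b, a−min) · ∏_{i=1}^{n} (1+x_i)^{−min} · h_b(x_1^{−1},…,x_n^{−1})], where h_b denotes the complete homogeneous symmetric polynomial of degree b in n variables and C(b, a−min) is the binomial coefficient (equal to 0 if a−min > b). Since min ≤ 0, each factor (1+x_i)^{−min} is a polynomial and the whole expression is a Laurent polynomial. In the special case u = v = 1, the equality holds under the weaker assumption that 0 ≤ b_1 ≤ b_2 ≤ … ≤ b_n. -/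

import Mathlib

open scoped BigOperators

/-- The coefficient ring `ℚ[u,v]`. -/
abbrev S2 : Type := MvPolynomial (Fin 2) ℚ

/-- The indeterminate `u`. -/
noncomputable def Uv : S2 := MvPolynomial.X 0

/-- The indeterminate `v`. -/
noncomputable def Vv : S2 := MvPolynomial.X 1

/-- A monotone triangle of order `n` (1-based indices, zero off the shape). -/
def IsMT (n : ℕ) (M : ℕ → ℕ → ℤ) : Prop :=
  (∀ i j, 1 ≤ j → j ≤ i → i < n → M (i+1) j ≤ M i j ∧ M i j ≤ M (i+1) (j+1)) ∧
  (∀ i j, 1 ≤ j → j < i → i < n → M i j < M i (j+1)) ∧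
  (∀ i j, ¬(1 ≤ j ∧ j ≤ i ∧ i ≤ n) → M i j = 0)

/-- `inv(M) = #{(i,j) : 1 ≤ j ≤ i < n, m_{i,j} = m_{i+1,j+1}}`. -/
def invMT (n : ℕ) (M : ℕ → ℕ → ℤ) : ℕ :=
  (((Finset.Icc 1 n) ×ˢ (Finset.Icc 1 n)).filter
    (fun p => p.2 ≤ p.1 ∧ p.1 < n ∧ M p.1 p.2 = M (p.1+1) (p.2+1))).card

/-- `inv'(M) = #{(i,j) : 1 ≤ j ≤ i < n, m_{i,j} = m_{i+1,j}}`. -/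
def invMT' (n : ℕ) (M : ℕ → ℕ → ℤ) : ℕ :=
  (((Finset.Icc 1 n) ×ˢ (Finset.Icc 1 n)).filter
    (fun p => p.2 ≤ p.1 ∧ p.1 < n ∧ M p.1 p.2 = M (p.1+1) p.2)).card

/-- The exponent vector `(n−1+d_1, …, n−1+d_n)`: taking this coefficient amounts to taking the
constant term after multiplying by `∏ x_i^{−n+1} x_i^{−d_i}`. -/
noncomputable def ctdeg2 (n : ℕ) (d : Fin n → ℕ) : ℕ →₀ ℕ :=
  (∑ i ∈ Finset.Icc 1 n, Finsupp.single i (n-1)) + ∑ i : Fin n, Finsupp.single ((i : ℕ) + 1) (d i)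

section MonotoneTriangleCount

open Finset MvPolynomial

section AlternatingCoefficient

variable {R : Type*} [CommRing R]

/-- The linear functional `f ↦ ∑_σ sgn σ · [x_1^{e (σ 1)} ⋯ x_n^{e (σ n)}] f`, extended to
polynomials in further variables by setting those variables to `1`. -/
noncomputable def altCoeff (n : ℕ) (e : Fin n → ℕ) : MvPolynomial ℕ R →ₗ[R] R :=
  (basisMonomials ℕ R).constr R fun m =>
    (Matrix.of fun i j : Fin n => if m ((i : ℕ) + 1) = e j then (1 : R) else 0).det

theorem altCoeff_monomial (n : ℕ) (e : Fin n → ℕ) (m : ℕ →₀ ℕ) (r : R) :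
    altCoeff n e (monomial m r) =
      r * (Matrix.of fun i j : Fin n => if m ((i : ℕ) + 1) = e j then (1 : R) else 0).det := by
  have h : monomial m r = r • (basisMonomials ℕ R m) := by
    simp [coe_basisMonomials, smul_monomial]
  rw [h, map_smul, altCoeff, Module.Basis.constr_basis, smul_eq_mul]

/-- Exchanging two of the relevant variables changes the sign of `altCoeff`. -/
theorem altCoeff_rename_swap {n : ℕ} (e : Fin n → ℕ) {s t : ℕ} (hs : 1 ≤ s) (hst : s < t)
    (ht : t ≤ n) (f : MvPolynomial ℕ R) :
    altCoeff n e (rename (Equiv.swap s t) f) = -altCoeff n e f := by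
  induction f using MvPolynomial.induction_on' with
  | add p q hp hq => simp only [map_add, hp, hq]; ring
  | monomial m r =>
    rw [rename_monomial, altCoeff_monomial, altCoeff_monomial, ← mul_neg]
    congr 1
    set i : Fin n := ⟨s - 1, by omega⟩ with hi
    set j : Fin n := ⟨t - 1, by omega⟩ with hj
    have hij : i ≠ j := by simp [hi, hj, Fin.ext_iff]; omega
    have key := Matrix.det_permute (Equiv.swap i j)
      (Matrix.of fun i j : Fin n => if m ((i : ℕ) + 1) = e j then (1 : R) else 0)
    rw [Equiv.Perm.sign_swap hij] at key
    rw [show -(Matrix.of fun i j : Fin n => if m ((i : ℕ) + 1) = e j then (1 : R) else 0).det =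
      ((-1 : ℤˣ) : ℤ) * (Matrix.of fun i j : Fin n =>
        if m ((i : ℕ) + 1) = e j then (1 : R) else 0).det by simp, ← key]
    congr 1
    ext k l
    have h1 : Finsupp.mapDomain (Equiv.swap s t) m ((k : ℕ) + 1) =
        m (((Equiv.swap i j k : Fin n) : ℕ) + 1) := by
      have h2 : ((k : ℕ) + 1) = Equiv.swap s t (((Equiv.swap i j k : Fin n) : ℕ) + 1) := by
        rw [Equiv.swap_apply_def, Equiv.swap_apply_def]
        split_ifs <;> simp_all [Fin.ext_iff] <;> omega
      conv_lhs => rw [h2]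
      exact Finsupp.mapDomain_apply (Equiv.swap s t).injective _ _
    simp only [Matrix.of_apply, Matrix.submatrix_apply, h1, id]

theorem altCoeff_eq_zero_of_rename_swap [IsDomain R] [CharZero R] {n : ℕ} (e : Fin n → ℕ)
    {s t : ℕ} (hs : 1 ≤ s) (hst : s < t) (ht : t ≤ n) {f : MvPolynomial ℕ R}
    (hf : rename (Equiv.swap s t) f = f) : altCoeff n e f = 0 := by
  have := altCoeff_rename_swap e hs hst ht f
  rw [hf] at this
  exact self_eq_neg.mp this

theorem altCoeff_prod_X_mul {n : ℕ} (e : Fin n → ℕ) (f : MvPolynomial ℕ R) :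
    altCoeff n (fun j => e j + 1) ((∏ i ∈ Icc 1 n, X i) * f) = altCoeff n e f := by
  induction f using MvPolynomial.induction_on' with
  | add p q hp hq => simp only [mul_add, map_add, hp, hq]
  | monomial m r =>
    have h : (∏ i ∈ Icc 1 n, X i : MvPolynomial ℕ R) =
        monomial (∑ i ∈ Icc 1 n, Finsupp.single i 1) 1 := by
      rw [monomial_sum_one]; rfl
    rw [h, monomial_mul, one_mul, altCoeff_monomial, altCoeff_monomial]
    congr 2
    ext i j
    have : (∑ i ∈ Icc 1 n, Finsupp.single i 1 : ℕ →₀ ℕ) ((i : ℕ) + 1) = 1 := by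
      simp [Finsupp.finsetSum_apply, Finsupp.single_apply]
    simp only [Matrix.of_apply, Finsupp.add_apply, this, add_comm 1, add_left_inj]

/-- Set the variable `x_k` to `0` and close the gap by shifting the later variables down. -/
noncomputable def delVar (k : ℕ) : MvPolynomial ℕ R →ₐ[R] MvPolynomial ℕ R :=
  aeval fun j => if j < k then X j else if j = k then 0 else X (j - 1)

theorem delVar_monomial (k : ℕ) (m : ℕ →₀ ℕ) (r : R) :
    delVar k (monomial m r) =
      if m k = 0 then monomial (m.mapDomain fun j => if j < k then j else j - 1) r else 0 := by
  rw [delVar, aeval_monomial]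
  split_ifs with h
  · rw [← rename_monomial, ← aeval_X_left_apply (rename _ _), aeval_rename, aeval_monomial]
    congr 1
    refine Finsupp.prod_congr fun j hj => ?_
    have : j ≠ k := by rintro rfl; simp [h] at hj
    simp only [Function.comp, this, if_false]
    split_ifs <;> rfl
  · rw [Finsupp.prod, prod_eq_zero (i := k) (by simpa using h), mul_zero]
    simp [h]

theorem altCoeff_succ {n : ℕ} (e : Fin (n + 1) → ℕ) (he : e 0 = 0) (f : MvPolynomial ℕ R) :
    altCoeff (n + 1) e f =
      ∑ k ∈ range (n + 1), (-1) ^ k * altCoeff n (fun j => e j.succ) (delVar (k + 1) f) := by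
  induction f using MvPolynomial.induction_on' with
  | add p q hp hq => simp only [map_add, hp, hq, mul_add, sum_add_distrib]
  | monomial m r =>
    rw [altCoeff_monomial, Matrix.det_succ_column_zero, mul_sum, sum_range]
    refine sum_congr rfl fun k _ => ?_
    rw [delVar_monomial]
    simp only [Matrix.of_apply, he]
    by_cases h : m ((k : ℕ) + 1) = 0
    · rw [if_pos h, if_pos h, altCoeff_monomial]
      rw [mul_one, mul_left_comm]
      congr 3
      ext i j
      simp only [Matrix.submatrix_apply, Matrix.of_apply]
      congr 2
      set φ : ℕ → ℕ := fun j => if j < (k : ℕ) + 1 then j else j - 1 with hφ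
      have h1 : ∀ a, m.mapDomain φ a = ∑ x ∈ m.support, if φ x = a then m x else 0 := by
        intro a
        simp [Finsupp.mapDomain, Finsupp.sum, Finsupp.finsetSum_apply, Finsupp.single_apply]
      rw [h1, sum_eq_single ((k.succAbove i : ℕ) + 1)]
      · rw [if_pos]
        simp only [hφ, Fin.succAbove, Fin.lt_def]
        split_ifs <;> simp_all
        all_goals omega
      · intro x hx hne
        rw [if_neg]
        have hxk : x ≠ (k : ℕ) + 1 := by rintro rfl; simp [h] at hx
        simp only [hφ, Fin.succAbove, Fin.lt_def] at hne ⊢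
        split_ifs at hne ⊢ <;> simp_all <;> omega
      · intro hx
        split_ifs
        · simpa using hx
        · rfl
    · simp [h]

end AlternatingCoefficient

section CompleteHomogeneous

variable {A : Type*} [CommRing A]

theorem sum_antidiagonalTuple_succ {M : Type*} [AddCommMonoid M] (n c : ℕ)
    (f : (Fin (n + 1) → ℕ) → M) :
    ∑ d ∈ Nat.antidiagonalTuple (n + 1) c, f d =
      ∑ l ∈ range (c + 1), ∑ d ∈ Nat.antidiagonalTuple n l, f (Fin.cons (c - l) d) := by
  rw [sum_sigma']
  refine sum_bij' (fun d _ => ⟨c - d 0, Fin.tail d⟩) (fun p _ => Fin.cons (c - p.1) p.2)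
    ?_ ?_ ?_ ?_ ?_
  · intro d hd
    rw [Nat.mem_antidiagonalTuple, Fin.sum_univ_succ] at hd
    simp only [mem_sigma, mem_range, Nat.mem_antidiagonalTuple, Fin.tail]
    omega
  · rintro ⟨l, d⟩ hp
    simp only [mem_sigma, mem_range, Nat.mem_antidiagonalTuple] at hp
    simp only [Nat.mem_antidiagonalTuple, Fin.sum_univ_succ, Fin.cons_zero, Fin.cons_succ, hp.2]
    omega
  · intro d hd
    rw [Nat.mem_antidiagonalTuple, Fin.sum_univ_succ] at hd
    have : c - (c - d 0) = d 0 := by omega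
    simp [this]
  · rintro ⟨l, d⟩ hp
    simp only [mem_sigma, mem_range] at hp
    have : c - (c - l) = l := by omega
    simp [this]
  · intro d hd
    rw [Nat.mem_antidiagonalTuple, Fin.sum_univ_succ] at hd
    have : c - (c - d 0) = d 0 := by omega
    simp [this]

/-- The complete homogeneous symmetric polynomial of degree `c`, evaluated at `x`. -/
def completeHomogeneous {n : ℕ} (c : ℕ) (x : Fin n → A) : A :=
  ∑ d ∈ Nat.antidiagonalTuple n c, ∏ i, x i ^ d i

theorem completeHomogeneous_succ {n : ℕ} (c : ℕ) (x : Fin (n + 1) → A) :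
    completeHomogeneous c x =
      ∑ l ∈ range (c + 1), x 0 ^ (c - l) * completeHomogeneous l (Fin.tail x) := by
  rw [completeHomogeneous, sum_antidiagonalTuple_succ]
  refine sum_congr rfl fun l _ => ?_
  rw [completeHomogeneous, mul_sum]
  refine sum_congr rfl fun d _ => ?_
  simp [Fin.prod_univ_succ, Fin.tail]

/-- The polynomial of degree at most `n` interpolating `t ^ (n + c)` at `n + 1` points has the
complete homogeneous symmetric polynomial of degree `c` as its top coefficient. -/
theorem exists_interpolating_pow (n : ℕ) : ∀ (x : Fin (n + 1) → A) (c : ℕ),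
    ∃ p : Polynomial A, p.natDegree ≤ n ∧ p.coeff n = completeHomogeneous c x ∧
      ∀ i, p.eval (x i) = x i ^ (n + c) := by
  induction n with
  | zero =>
    intro x c
    refine ⟨Polynomial.C (x 0 ^ c), (Polynomial.natDegree_C _).le, ?_, fun i => ?_⟩
    · rw [Polynomial.coeff_C_zero]
      simp [completeHomogeneous]
    · obtain rfl : i = 0 := Fin.fin_one_eq_zero i
      rw [Polynomial.eval_C, zero_add c]
  | succ n ih =>
    intro x c
    choose q hdeg hcoeff heval using ih (Fin.tail x)
    set r : Polynomial A := ∑ l ∈ range n, Polynomial.C (x 0 ^ (n + c - l)) * Polynomial.X ^ l +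
      ∑ l ∈ range (c + 1), Polynomial.C (x 0 ^ (c - l)) * q l with hr
    have hrdeg : r.natDegree ≤ n := by
      refine Polynomial.natDegree_add_le_of_degree_le ?_ ?_
      · refine Polynomial.natDegree_sum_le_of_forall_le _ _ fun l hl => ?_
        exact (Polynomial.natDegree_C_mul_X_pow_le _ _).trans (mem_range.mp hl).le
      · refine Polynomial.natDegree_sum_le_of_forall_le _ _ fun l _ => ?_
        exact (Polynomial.natDegree_C_mul_le _ _).trans (hdeg l)
    have hrcoeff : r.coeff n = completeHomogeneous c x := by
      rw [hr, Polynomial.coeff_add, Polynomial.finsetSum_coeff, sum_eq_zero, zero_add,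
        Polynomial.finsetSum_coeff, completeHomogeneous_succ]
      · refine sum_congr rfl fun l _ => ?_
        rw [Polynomial.coeff_C_mul, hcoeff]
      · intro l hl
        rw [Polynomial.coeff_C_mul_X_pow, if_neg (mem_range.mp hl).ne']
    have hreval : ∀ i : Fin (n + 1), r.eval (x i.succ) =
        ∑ l ∈ range (n + c + 1), x i.succ ^ l * x 0 ^ (n + c - l) := by
      intro i
      rw [add_assoc, sum_range_add, hr, Polynomial.eval_add, Polynomial.eval_finsetSum,
        Polynomial.eval_finsetSum]
      congr 1
      · refine sum_congr rfl fun l _ => ?_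
        simp [mul_comm]
      · refine sum_congr rfl fun l _ => ?_
        rw [Nat.add_sub_add_left, Polynomial.eval_mul, Polynomial.eval_C, mul_comm]
        congr 1
        exact heval l i
    refine ⟨Polynomial.C (x 0 ^ (n + 1 + c)) + (Polynomial.X - Polynomial.C (x 0)) * r,
      ?_, ?_, ?_⟩
    · refine Polynomial.natDegree_add_le_of_degree_le
        ((Polynomial.natDegree_C _).le.trans (Nat.zero_le _)) ?_
      refine Polynomial.natDegree_mul_le.trans ?_
      have := Polynomial.natDegree_X_sub_C_le (x 0)
      omega
    · rw [sub_mul, Polynomial.coeff_add, Polynomial.coeff_sub, Polynomial.coeff_X_mul,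
        Polynomial.coeff_C_mul, Polynomial.coeff_C_succ,
        Polynomial.coeff_eq_zero_of_natDegree_lt (p := r) (n := n + 1) (by omega), hrcoeff]
      ring
    · intro i
      refine Fin.cases ?_ (fun i => ?_) i
      · simp
      · have h := Commute.mul_geom_sum₂ (Commute.all (x i.succ) (x 0)) (n + c + 1)
        simp only [Nat.add_sub_cancel] at h
        rw [Polynomial.eval_add, Polynomial.eval_mul, hreval]
        simp only [Polynomial.eval_C, Polynomial.eval_sub, Polynomial.eval_X]
        rw [h, show n + 1 + c = n + c + 1 by ring]
        ring

/-- The exponents `0, 1, …, n - 2, n - 1 + c`. -/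
def rowExponent (n c : ℕ) (j : Fin n) : ℕ :=
  if (j : ℕ) + 1 = n then j + c else j

/-- The bialternant formula for a one-row partition. -/
theorem det_pow_rowExponent (n c : ℕ) (hn : 1 ≤ n) (x : Fin n → A) :
    (Matrix.of fun i j => x i ^ rowExponent n c j).det =
      (Matrix.vandermonde x).det * completeHomogeneous c x := by
  obtain ⟨n, rfl⟩ : ∃ k, n = k + 1 := ⟨n - 1, by omega⟩
  obtain ⟨p, hdeg, hcoeff, heval⟩ := exists_interpolating_pow n x c
  have key := Matrix.det_updateCol_sum (Matrix.vandermonde x) (Fin.last n)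
    (fun j => p.coeff j)
  rw [Fin.val_last, hcoeff, smul_eq_mul] at key
  rw [mul_comm, ← key]
  congr 1
  ext i j
  rw [Matrix.of_apply, Matrix.updateCol_apply, rowExponent]
  split_ifs with h1 h2 h2
  · rw [h2, Fin.val_last, ← heval, Polynomial.eval_eq_sum_range' (Nat.lt_succ_of_le hdeg),
      sum_range]
    simp [Matrix.vandermonde_apply]
  · exact absurd (Fin.ext (by simpa using h1)) h2
  · exact absurd (by simp [h2]) h1
  · simp [Matrix.vandermonde_apply]

end CompleteHomogeneous

section Duality

variable {R : Type*} [CommRing R]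

theorem coeff_monomial_mul_det {n : ℕ} (k m : Fin n →₀ ℕ) (e : Fin n → ℕ) :
    coeff k (monomial m (1 : R) * (Matrix.of fun i j : Fin n => X i ^ e j).det) =
      ∑ σ : Equiv.Perm (Fin n), ((Equiv.Perm.sign σ : ℤ) : R) *
        if ∀ i, k (σ i) = m (σ i) + e i then 1 else 0 := by
  rw [Matrix.det_apply', mul_sum, coeff_sum]
  refine sum_congr rfl fun σ _ => ?_
  have h : (∏ i, (Matrix.of fun i j : Fin n => X i ^ e j) (σ i) i : MvPolynomial (Fin n) R) =
      monomial (Finsupp.equivFunOnFinite.symm fun i => e (σ.symm i)) 1 := by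
    rw [monomial_eq, Finsupp.prod_fintype _ _ (by simp), C_1, one_mul, ← Equiv.prod_comp σ
      (fun i => X i ^ (Finsupp.equivFunOnFinite.symm fun i => e (σ.symm i)) i)]
    simp
  rw [h, ← map_intCast (C : R →+* MvPolynomial (Fin n) R), mul_left_comm, monomial_mul,
    coeff_C_mul, coeff_monomial, one_mul]
  congr 1
  refine if_congr ?_ rfl rfl
  rw [Finsupp.ext_iff, ← σ.forall_congr_right (q := fun a => _ = k a)]
  simp [eq_comm]

theorem det_ite_eq {n : ℕ} (m e : Fin n → ℕ) :
    (Matrix.of fun i j : Fin n => if m i = e j then (1 : R) else 0).det =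
      ∑ σ : Equiv.Perm (Fin n), ((Equiv.Perm.sign σ : ℤ) : R) *
        if ∀ i, m (σ i) = e i then 1 else 0 := by
  rw [Matrix.det_apply']
  refine sum_congr rfl fun σ _ => ?_
  simp [Finset.prod_ite_zero]

theorem sum_Icc_one_eq_sum_range {M : Type*} [AddCommMonoid M] (n : ℕ) (f : ℕ → M) :
    ∑ i ∈ Icc 1 n, f i = ∑ i ∈ range n, f (i + 1) := by
  rw [range_eq_Ico, sum_Ico_add' f 0 n 1]
  rfl

theorem ctdeg2_eq_mapDomain (n : ℕ) (d : Fin n → ℕ) :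
    ctdeg2 n d = (Finsupp.equivFunOnFinite.symm fun i => n - 1 + d i).mapDomain
      fun i : Fin n => (i : ℕ) + 1 := by
  have h : ∑ i ∈ Icc 1 n, Finsupp.single i (n - 1) =
      ∑ i : Fin n, Finsupp.single ((i : ℕ) + 1) (n - 1) := by
    rw [Fin.sum_univ_eq_sum_range (fun i => Finsupp.single (i + 1) (n - 1)),
      sum_Icc_one_eq_sum_range]
  rw [ctdeg2, h, ← sum_add_distrib, Finsupp.mapDomain, Finsupp.sum_fintype _ _ (by simp)]
  simp

/-- The pairs `(i, j)` with `1 ≤ i < j ≤ n`. -/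
def ltPairs (n : ℕ) : Finset (ℕ × ℕ) :=
  (Icc 1 n ×ˢ Icc 1 n).filter fun p => p.1 < p.2

theorem mem_ltPairs {n : ℕ} {p : ℕ × ℕ} : p ∈ ltPairs n ↔ 1 ≤ p.1 ∧ p.1 < p.2 ∧ p.2 ≤ n := by
  simp only [ltPairs, mem_filter, mem_product, mem_Icc]
  omega

theorem prod_ltPairs_sub (n : ℕ) :
    (∏ p ∈ ltPairs n, (X p.1 - X p.2) : MvPolynomial ℕ R) =
      rename (fun i : Fin n => (i : ℕ) + 1)
        (Matrix.of fun i j : Fin n => X i ^ (j.rev : ℕ)).det := by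
  have h := Matrix.det_projVandermonde (n := n) 1 (X : Fin n → MvPolynomial (Fin n) R)
  have h2 : Matrix.projVandermonde 1 (X : Fin n → MvPolynomial (Fin n) R) =
      Matrix.of fun i j : Fin n => X i ^ (j.rev : ℕ) := by
    ext1 i j
    simp [Matrix.projVandermonde_apply]
  rw [← h2, h, map_prod]
  simp only [map_prod, map_sub, Pi.one_apply, one_mul, rename_X]
  rw [prod_sigma']
  symm
  refine prod_bij' (fun p _ => ((p.1 : ℕ) + 1, (p.2 : ℕ) + 1))
    (fun p hp => ⟨⟨p.1 - 1, by rw [mem_ltPairs] at hp; omega⟩,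
      ⟨p.2 - 1, by rw [mem_ltPairs] at hp; omega⟩⟩) ?_ ?_ ?_ ?_ ?_
  · rintro ⟨i, j⟩ hp
    simp only [mem_sigma, mem_univ, mem_Ioi, true_and, Fin.lt_def] at hp
    simp only [mem_ltPairs]
    omega
  · rintro ⟨i, j⟩ hp
    simp only [mem_ltPairs] at hp
    simp only [mem_sigma, mem_univ, mem_Ioi, true_and, Fin.lt_def]
    omega
  · rintro ⟨i, j⟩ hp
    simp
  · rintro ⟨i, j⟩ hp
    simp only [mem_ltPairs] at hp
    ext <;> simp <;> omega
  · rintro ⟨i, j⟩ hp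
    simp

/-- The constant term of `f` times the antisymmetrizer kernel and `h_c(x⁻¹)` is an alternating
sum of coefficients of `f`. -/
theorem sum_coeff_ctdeg2 {n : ℕ} (hn : 1 ≤ n) (c : ℕ) {f : MvPolynomial ℕ R}
    (hf : f ∈ supported R (Set.Icc 1 n)) :
    ∑ d ∈ Nat.antidiagonalTuple n c,
        coeff (ctdeg2 n d) (f * ∏ p ∈ ltPairs n, (X p.1 - X p.2)) =
      altCoeff n (rowExponent n c) f := by
  have hinj : Function.Injective fun i : Fin n => (i : ℕ) + 1 := fun i j h => by
    simpa [Fin.ext_iff] using h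
  have hrange : Set.Icc 1 n ⊆ Set.range fun i : Fin n => (i : ℕ) + 1 := fun i hi => by
    rw [Set.mem_Icc] at hi
    exact ⟨⟨i - 1, by omega⟩, by simp; omega⟩
  obtain ⟨g, rfl⟩ := exists_rename_eq_of_vars_subset_range f _ hinj
    ((mem_supported.mp hf).trans hrange)
  rw [prod_ltPairs_sub]
  simp only [ctdeg2_eq_mapDomain, ← map_mul, coeff_rename_mapDomain _ hinj]
  clear hf
  induction g using MvPolynomial.induction_on' with
  | add p q hp hq =>
    rw [map_add, map_add, ← hp, ← hq, ← sum_add_distrib]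
    simp only [add_mul, coeff_add]
  | monomial m r =>
    rw [rename_monomial, altCoeff_monomial]
    simp only [Finsupp.mapDomain_apply hinj]
    have hr : (monomial m r : MvPolynomial (Fin n) R) = C r * monomial m 1 := by
      rw [C_mul_monomial, mul_one]
    simp only [hr, mul_assoc, coeff_C_mul, ← mul_sum]
    congr 1
    have hV := congrArg (coeff m)
      (det_pow_rowExponent n c hn (X : Fin n → MvPolynomial (Fin n) R))
    have h1 := coeff_monomial_mul_det (R := R) m 0 (rowExponent n c)
    rw [show (monomial (0 : Fin n →₀ ℕ) (1 : R)) = 1 from rfl, one_mul] at h1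
    simp only [Finsupp.coe_zero, Pi.zero_apply, zero_add] at h1
    rw [det_ite_eq, ← h1, hV, completeHomogeneous, mul_sum, coeff_sum]
    refine sum_congr rfl fun d _ => ?_
    have h2 : (∏ i, X i ^ d i : MvPolynomial (Fin n) R) =
        monomial (Finsupp.equivFunOnFinite.symm d) 1 := by
      rw [monomial_eq, Finsupp.prod_fintype _ _ (by simp), C_1, one_mul]
      simp
    rw [coeff_monomial_mul_det, h2, mul_comm (Matrix.det _),
      show Matrix.vandermonde (X : Fin n → MvPolynomial (Fin n) R) =
        Matrix.of fun i j : Fin n => (X i : MvPolynomial (Fin n) R) ^ (j : ℕ) by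
          ext1 i j; simp [Matrix.vandermonde_apply], coeff_monomial_mul_det]
    refine sum_congr rfl fun σ _ => ?_
    congr 1
    refine if_congr (forall_congr' fun i => ?_) rfl rfl
    simp only [Finsupp.equivFunOnFinite_symm_apply_apply, Fin.val_rev]
    omega

end Duality

section Negligible

variable {R : Type*} [CommRing R]

theorem rename_eq_self_of_mem_supported {s : Set ℕ} {f : MvPolynomial ℕ R}
    (hf : f ∈ supported R s) {σ : ℕ → ℕ} (hσ : ∀ i ∈ s, σ i = i) : rename σ f = f := by
  have h : Set.EqOn (rename σ : MvPolynomial ℕ R →ₐ[R] MvPolynomial ℕ R)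
      (AlgHom.id R (MvPolynomial ℕ R)) ((Algebra.adjoin R (X '' s) :
        Subalgebra R (MvPolynomial ℕ R)) : Set (MvPolynomial ℕ R)) := by
    rw [AlgHom.eqOn_adjoin_iff]
    rintro _ ⟨i, hi, rfl⟩
    simp [hσ i hi]
  exact h hf

/-- The factor attached to the pair of variables `x_i, x_j`. -/
noncomputable def pairFactor (u v : R) (i j : ℕ) : MvPolynomial ℕ R :=
  1 + C (1 - v) * X i + C u * (X j + X i * X j)

/-- The product of the pair factors over all pairs `i < j`. -/
noncomputable def pairProd (u v : R) (n : ℕ) : MvPolynomial ℕ R :=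
  ∏ p ∈ ltPairs n, pairFactor u v p.1 p.2

theorem rename_pairFactor (u v : R) (σ : ℕ → ℕ) (i j : ℕ) :
    rename σ (pairFactor u v i j) = pairFactor u v (σ i) (σ j) := by
  simp [pairFactor]

theorem rename_swap_prod_pairFactor (u v : R) {s t : ℕ} {S : Finset (ℕ × ℕ)}
    (hS : ∀ p ∈ S, (Equiv.swap s t p.1, Equiv.swap s t p.2) ∈ S) :
    rename (Equiv.swap s t) (∏ p ∈ S, pairFactor u v p.1 p.2) =
      ∏ p ∈ S, pairFactor u v p.1 p.2 := by
  rw [map_prod]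
  refine prod_nbij' (fun p => (Equiv.swap s t p.1, Equiv.swap s t p.2))
    (fun p => (Equiv.swap s t p.1, Equiv.swap s t p.2)) hS hS ?_ ?_ ?_
  · simp
  · simp
  · intro p _
    rw [rename_pairFactor]

/-- The polynomials `p` such that `p * s * ∏ pairFactor` is annihilated by `altCoeff` for every
polynomial `s` in the variables after the `k`-th one. -/
noncomputable def negligible (u v : R) {n : ℕ} (e : Fin n → ℕ) (k : ℕ) :
    AddSubgroup (MvPolynomial ℕ R) where
  carrier := {p | k ≤ n → ∀ s ∈ supported R (Set.Ioi k),
    altCoeff n e (p * s * pairProd u v n) = 0}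
  zero_mem' := by intro _ s _; simp
  add_mem' := by
    intro p q hp hq hk s hs
    rw [add_mul, add_mul, map_add, hp hk s hs, hq hk s hs, add_zero]
  neg_mem' := by
    intro p hp hk s hs
    rw [neg_mul, neg_mul, map_neg, hp hk s hs, neg_zero]

variable {u v : R} {n : ℕ} {e : Fin n → ℕ}

theorem mul_mem_negligible {k l : ℕ} (hkl : k ≤ l) {p q : MvPolynomial ℕ R}
    (hp : p ∈ negligible u v e k) (hq : q ∈ supported R (Set.Ioi k)) :
    p * q ∈ negligible u v e l := by
  intro hl s hs
  rw [mul_assoc p]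
  exact hp (hkl.trans hl) _
    (mul_mem hq (supported_mono (Set.Ioi_subset_Ioi hkl) hs))

theorem mem_negligible_of_swap [IsDomain R] [CharZero R] {t : ℕ} (ht : 1 ≤ t)
    {p : MvPolynomial ℕ R}
    (hp : rename (Equiv.swap t (t + 1)) (p * pairFactor u v t (t + 1)) =
      p * pairFactor u v t (t + 1)) :
    p ∈ negligible u v e (t + 1) := by
  intro hn s hs
  refine altCoeff_eq_zero_of_rename_swap e ht (Nat.lt_succ_self t) hn ?_
  have hmem : (t, t + 1) ∈ ltPairs n := by rw [mem_ltPairs]; simp; omega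
  have hprod : p * s * pairProd u v n = p * pairFactor u v t (t + 1) * s *
      ∏ q ∈ (ltPairs n).erase (t, t + 1), pairFactor u v q.1 q.2 := by
    rw [pairProd, ← mul_prod_erase _ _ hmem]
    ring
  rw [hprod, map_mul, map_mul, hp, rename_eq_self_of_mem_supported hs,
    rename_swap_prod_pairFactor]
  · rintro ⟨i, j⟩ h
    simp only [mem_erase, mem_ltPairs, ne_eq, Prod.mk.injEq] at h ⊢
    simp only [Equiv.swap_apply_def]
    split_ifs <;> omega
  · intro i hi
    rw [Set.mem_Ioi] at hi
    exact Equiv.swap_apply_of_ne_of_ne (by omega) (by omega)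

/-- For `u = v = 1` the antisymmetrization of the product of pair factors over three variables
vanishes. -/
theorem mem_negligible_of_swap_of_swap [IsDomain R] [CharZero R] {t : ℕ} (ht : 1 ≤ t)
    {p : MvPolynomial ℕ R} (h1 : rename (Equiv.swap t (t + 1)) p = p)
    (h2 : rename (Equiv.swap (t + 1) (t + 2)) p = p) :
    p ∈ negligible (1 : R) 1 e (t + 2) := by
  intro hn s hs
  set S := (ltPairs n).filter fun q => ¬(t ≤ q.1 ∧ q.2 ≤ t + 2) with hS
  set B := p * s * ∏ q ∈ S, pairFactor (1 : R) 1 q.1 q.2 with hB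
  have hprod : p * s * pairProd 1 1 n = B * (pairFactor 1 1 t (t + 1) *
      pairFactor 1 1 t (t + 2) * pairFactor 1 1 (t + 1) (t + 2)) := by
    rw [pairProd, ← prod_filter_mul_prod_filter_not (ltPairs n)
      (fun q => t ≤ q.1 ∧ q.2 ≤ t + 2)]
    have : (ltPairs n).filter (fun q => t ≤ q.1 ∧ q.2 ≤ t + 2) =
        {(t, t + 1), (t, t + 2), (t + 1, t + 2)} := by
      ext ⟨i, j⟩
      simp only [mem_filter, mem_ltPairs, mem_insert, mem_singleton, Prod.mk.injEq]
      omega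
    rw [this, prod_insert (by simp), prod_insert (by simp), prod_singleton]
    ring
  have hsw : ∀ a, t ≤ a → a ≤ t + 1 → rename (Equiv.swap a (a + 1)) p = p →
      rename (Equiv.swap a (a + 1)) B = B := by
    intro a ha ha' hp
    rw [hB, map_mul, map_mul, hp, rename_eq_self_of_mem_supported hs,
      rename_swap_prod_pairFactor]
    · rintro ⟨i, j⟩ h
      simp only [hS, mem_filter, mem_ltPairs] at h ⊢
      simp only [Equiv.swap_apply_def]
      split_ifs <;> omega
    · intro i hi
      rw [Set.mem_Ioi] at hi
      exact Equiv.swap_apply_of_ne_of_ne (by omega) (by omega)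
  set φ : ℕ → ℕ → ℕ → R := fun a b c => altCoeff n e (B * (pairFactor 1 1 a b *
      pairFactor 1 1 a c * pairFactor 1 1 b c)) with hφ
  have hσ : ∀ (d : ℕ), t ≤ d → d ≤ t + 1 → rename (Equiv.swap d (d + 1)) p = p →
      ∀ a b c, φ (Equiv.swap d (d + 1) a) (Equiv.swap d (d + 1) b) (Equiv.swap d (d + 1) c) =
        -φ a b c := by
    intro d hd hd' hp a b c
    have := altCoeff_rename_swap e (ht.trans hd) (Nat.lt_succ_self d) (by omega : d + 1 ≤ n)
      (B * (pairFactor 1 1 a b * pairFactor 1 1 a c * pairFactor 1 1 b c))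
    simp only [map_mul, rename_pairFactor, hsw d hd hd' hp] at this
    exact this
  have hs1 := hσ t le_rfl (by omega) h1
  have hs2 := hσ (t + 1) (by omega) le_rfl h2
  have a1 : Equiv.swap t (t + 1) (t + 2) = t + 2 :=
    Equiv.swap_apply_of_ne_of_ne (by omega) (by omega)
  have a2 : Equiv.swap (t + 1) (t + 1 + 1) t = t :=
    Equiv.swap_apply_of_ne_of_ne (by omega) (by omega)
  have a3 : Equiv.swap (t + 1) (t + 1 + 1) (t + 2) = t + 1 := Equiv.swap_apply_right _ _
  have b1 := hs1 t (t + 1) (t + 2)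
  have b2 := hs2 t (t + 1) (t + 2)
  have b3 := hs1 t (t + 2) (t + 1)
  have b4 := hs2 (t + 1) t (t + 2)
  have b5 := hs1 (t + 2) t (t + 1)
  simp only [Equiv.swap_apply_left, Equiv.swap_apply_right, a1, a2, a3] at b1 b2 b3 b4 b5
  have hzero : φ t (t + 1) (t + 2) - φ (t + 1) t (t + 2) - φ t (t + 2) (t + 1)
      + φ (t + 1) (t + 2) t + φ (t + 2) t (t + 1) - φ (t + 2) (t + 1) t = 0 := by
    simp only [hφ, ← map_sub, ← map_add]
    refine (congrArg _ ?_).trans (LinearMap.map_zero (altCoeff n e))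
    simp only [pairFactor, sub_self, C_0, C_1]
    ring
  rw [hprod]
  change φ t (t + 1) (t + 2) = 0
  have h6 : (6 : R) * φ t (t + 1) (t + 2) = 0 := by
    simp only [show t + 1 + 1 = t + 2 from rfl] at *
    linear_combination hzero + 3 * b1 + 2 * b2 - b3 - 2 * b4 + b5
  exact (mul_eq_zero.mp h6).resolve_left (by norm_num)

end Negligible

section Rows

open Classical in
/-- The strictly increasing rows `(c_1, …, c_k)` with `b_i ≤ c_i ≤ b_{i+1}`, extended by zero. -/
noncomputable def interlacingRows (b : ℕ → ℤ) : ℕ → Finset (ℕ → ℤ)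
  | 0 => {0}
  | k + 1 => (interlacingRows b k).biUnion fun c =>
      ((Icc (b (k + 1)) (b (k + 2))).filter fun t => k = 0 ∨ c k < t).image fun t =>
        Function.update c (k + 1) t

theorem mem_interlacingRows {b : ℕ → ℤ} {k : ℕ} {c : ℕ → ℤ} :
    c ∈ interlacingRows b k ↔ (∀ i, 1 ≤ i → i ≤ k → b i ≤ c i ∧ c i ≤ b (i + 1)) ∧
      (∀ i, 1 ≤ i → i < k → c i < c (i + 1)) ∧ ∀ i, ¬(1 ≤ i ∧ i ≤ k) → c i = 0 := by
  induction k generalizing c with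
  | zero =>
    simp only [interlacingRows, mem_singleton]
    constructor
    · rintro rfl
      exact ⟨fun i h h' => by omega, fun i h h' => by omega, fun i _ => rfl⟩
    · rintro ⟨-, -, h⟩
      exact funext fun i => h i (by omega)
  | succ k ih =>
    simp only [interlacingRows, mem_biUnion, mem_image, mem_filter, mem_Icc]
    constructor
    · rintro ⟨c, hc, t, ⟨⟨h1, h2⟩, h3⟩, rfl⟩
      obtain ⟨hc1, hc2, hc3⟩ := ih.mp hc
      refine ⟨fun i hi hi' => ?_, fun i hi hi' => ?_, fun i hi => ?_⟩
      · rcases eq_or_ne i (k + 1) with rfl | hne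
        · simpa using ⟨h1, h2⟩
        · rw [Function.update_of_ne hne]
          exact hc1 i hi (by omega)
      · rw [Function.update_of_ne (by omega : i ≠ k + 1)]
        rcases eq_or_ne i k with rfl | hne
        · rw [Function.update_self]
          exact h3.resolve_left (by omega)
        · rw [Function.update_of_ne (by omega : i + 1 ≠ k + 1)]
          exact hc2 i hi (by omega)
      · rw [Function.update_of_ne (by omega : i ≠ k + 1)]
        exact hc3 i (by omega)
    · rintro ⟨h1, h2, h3⟩
      refine ⟨Function.update c (k + 1) 0, ih.mpr ⟨fun i hi hi' => ?_, fun i hi hi' => ?_,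
        fun i hi => ?_⟩, c (k + 1), ⟨h1 (k + 1) (by omega) le_rfl, ?_⟩, by simp⟩
      · rw [Function.update_of_ne (by omega : i ≠ k + 1)]
        exact h1 i hi (by omega)
      · rw [Function.update_of_ne (by omega : i ≠ k + 1),
          Function.update_of_ne (by omega : i + 1 ≠ k + 1)]
        exact h2 i hi (by omega)
      · rcases eq_or_ne i (k + 1) with rfl | hne
        · simp
        · rw [Function.update_of_ne hne]
          exact h3 i (by omega)
      · rcases Nat.eq_zero_or_pos k with rfl | hk
        · exact Or.inl rfl
        · right
          rw [Function.update_of_ne (by omega : k ≠ k + 1)]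
          exact h2 k hk (by omega)

theorem sum_interlacingRows_succ {M : Type*} [AddCommMonoid M] (b : ℕ → ℤ) (k : ℕ)
    (f : (ℕ → ℤ) → M) :
    ∑ c ∈ interlacingRows b (k + 1), f c = ∑ c ∈ interlacingRows b k,
      ∑ t ∈ (Icc (b (k + 1)) (b (k + 2))).filter (fun t => k = 0 ∨ c k < t),
        f (Function.update c (k + 1) t) := by
  classical
  have hz : ∀ c ∈ interlacingRows b k, c (k + 1) = 0 := fun c hc =>
    (mem_interlacingRows.mp hc).2.2 _ (by omega)
  rw [interlacingRows, sum_biUnion]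
  · refine sum_congr rfl fun c _ => sum_image fun t _ t' _ h => ?_
    simpa using congrFun h (k + 1)
  · intro c hc c' hc' hne
    rw [Function.onFun, disjoint_left]
    rintro d hd hd'
    obtain ⟨t, -, rfl⟩ := mem_image.mp hd
    obtain ⟨t', -, h⟩ := mem_image.mp hd'
    refine hne (funext fun i => ?_)
    rcases eq_or_ne i (k + 1) with rfl | hi
    · rw [hz c hc, hz c' hc']
    · simpa [hi] using (congrFun h i).symm

variable {R : Type*} [CommRing R] (u v : R) (mn : ℤ) (b : ℕ → ℤ)

/-- `(1 + x_i) ^ (t - mn)`. -/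
noncomputable def shiftPow (i : ℕ) (t : ℤ) : MvPolynomial ℕ R :=
  (1 + X i) ^ (t - mn).toNat

/-- The weight of the entry `t` in position `i` of a row above the row `b`. -/
def entryWeight (i : ℕ) (t : ℤ) : R :=
  (if t = b (i + 1) then u else 1) * (if t = b i then v else 1)

/-- The weighted contribution of the entry `t` in position `i`. -/
noncomputable def entryTerm (i : ℕ) (t : ℤ) : MvPolynomial ℕ R :=
  C (entryWeight u v b i t) * shiftPow mn i t

/-- The product of the contributions of the first `k` entries of the row `c`. -/
noncomputable def rowTerm (k : ℕ) (c : ℕ → ℤ) : MvPolynomial ℕ R :=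
  ∏ i ∈ Icc 1 k, entryTerm u v mn b i (c i)

/-- The sum of the contributions of the rows of length `k` above the row `b`. -/
noncomputable def rowSum (k : ℕ) : MvPolynomial ℕ R :=
  ∑ c ∈ interlacingRows b k, rowTerm u v mn b k c

/-- The boundary term of `X_mul_sum_entryTerm` at the lower bound `b_i`. -/
noncomputable def lowerTerm (i : ℕ) : MvPolynomial ℕ R :=
  shiftPow mn i (b i) * (1 + C (1 - v) * X i)

/-- The boundary term of `X_mul_sum_entryTerm` at the upper bound `b_{i+1}`. -/
noncomputable def upperTerm (i : ℕ) : MvPolynomial ℕ R :=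
  shiftPow mn i (b (i + 1)) * (1 + C u * X i)

theorem X_mul_sum_Ico_shiftPow (i : ℕ) {p q : ℤ} (hp : mn ≤ p) (hpq : p ≤ q) :
    X i * ∑ t ∈ Ico p q, (shiftPow mn i t : MvPolynomial ℕ R) =
      shiftPow mn i q - shiftPow mn i p := by
  induction q, hpq using Int.leInduction with
  | base => simp
  | succ q hq ih =>
    rw [← insert_Ico_right_eq_Ico_add_one hq, sum_insert (by simp), mul_add, ih]
    have : (q + 1 - mn).toNat = (q - mn).toNat + 1 := by omega
    rw [shiftPow, shiftPow, shiftPow, this]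
    ring

theorem X_mul_sum_entryTerm {i : ℕ} (hmn : mn ≤ b i)
    (h : b i < b (i + 1) ∨ b i = b (i + 1) ∧ u = 1 ∧ v = 1) :
    X i * ∑ t ∈ Icc (b i) (b (i + 1)), entryTerm u v mn b i t =
      upperTerm u mn b i - lowerTerm v mn b i := by
  have hle : b i ≤ b (i + 1) := by rcases h with h | h <;> omega
  have hexp : ∀ t, entryTerm u v mn b i t = shiftPow mn i t
      + (if t = b (i + 1) then C (u - 1) * shiftPow mn i t else 0)
      + (if t = b i then C (v - 1) * shiftPow mn i t else 0) := by
    intro t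
    rw [entryTerm, entryWeight]
    split_ifs with h1 h2 h2
    · rcases h with h | ⟨-, rfl, rfl⟩
      · omega
      · simp
    all_goals simp only [mul_one, one_mul, C_sub, C_1]; ring
  simp only [hexp, sum_add_distrib, sum_ite_eq', mem_Icc, le_refl, hle, and_self, if_true]
  rw [← Ico_insert_right hle, sum_insert (by simp)]
  have := X_mul_sum_Ico_shiftPow (R := R) mn i hmn hle
  simp only [upperTerm, lowerTerm, C_sub, C_1]
  linear_combination this

theorem rowTerm_update (k : ℕ) (c : ℕ → ℤ) (t : ℤ) :
    rowTerm u v mn b (k + 1) (Function.update c (k + 1) t) =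
      rowTerm u v mn b k c * entryTerm u v mn b (k + 1) t := by
  rw [rowTerm, prod_Icc_succ_top (by omega), Function.update_self, rowTerm]
  congr 1
  refine prod_congr rfl fun i hi => ?_
  rw [Function.update_of_ne]
  rw [mem_Icc] at hi
  omega

/-- The sum over rows of length `k` that can be prolonged by the entry `t`. -/
noncomputable def rowSumBelow (k : ℕ) (t : ℤ) : MvPolynomial ℕ R :=
  ∑ c ∈ interlacingRows b k, if k = 0 ∨ c k < t then rowTerm u v mn b k c else 0

/-- The sum over rows of length `k` whose last entry is `t`. -/
noncomputable def rowSumLast (k : ℕ) (t : ℤ) : MvPolynomial ℕ R :=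
  ∑ c ∈ interlacingRows b k, if k ≠ 0 ∧ c k = t then rowTerm u v mn b k c else 0

theorem rowSumLast_succ {k : ℕ} {t : ℤ} (h1 : b (k + 1) ≤ t) (h2 : t ≤ b (k + 2)) :
    rowSumLast u v mn b (k + 1) t =
      rowSumBelow u v mn b k t * entryTerm u v mn b (k + 1) t := by
  rw [rowSumLast, sum_interlacingRows_succ, rowSumBelow, sum_mul]
  refine sum_congr rfl fun c _ => ?_
  simp only [ne_eq, Nat.succ_ne_zero, not_false_eq_true, true_and, Function.update_self,
    rowTerm_update, sum_ite_eq', mem_filter, mem_Icc, h1, h2, ite_mul, zero_mul]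

theorem rowSumBelow_eq {k : ℕ} {t : ℤ} (h : 1 ≤ k → b (k + 1) ≤ t) :
    rowSumBelow u v mn b k t = rowSum u v mn b k - rowSumLast u v mn b k t := by
  rw [rowSumBelow, rowSum, rowSumLast, ← sum_sub_distrib]
  refine sum_congr rfl fun c hc => ?_
  rcases Nat.eq_zero_or_pos k with rfl | hk
  · simp
  · have := ((mem_interlacingRows.mp hc).1 k hk le_rfl).2
    have := h hk
    rcases lt_or_eq_of_le (by omega : c k ≤ t) with hlt | heq
    · simp [hlt, hlt.ne]
    · simp [heq, hk.ne']

theorem rowSum_succ {k : ℕ} (hle : b (k + 1) ≤ b (k + 2)) :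
    rowSum u v mn b (k + 1) =
      rowSum u v mn b k * ∑ t ∈ Icc (b (k + 1)) (b (k + 2)), entryTerm u v mn b (k + 1) t
        - rowSumLast u v mn b k (b (k + 1)) * entryTerm u v mn b (k + 1) (b (k + 1)) := by
  rw [rowSum, sum_interlacingRows_succ, rowSum, rowSumLast, sum_mul, sum_mul, ← sum_sub_distrib]
  refine sum_congr rfl fun c hc => ?_
  simp only [rowTerm_update, ← mul_sum]
  rcases Nat.eq_zero_or_pos k with rfl | hk
  · simp
  · have hck := ((mem_interlacingRows.mp hc).1 k hk le_rfl).2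
    split_ifs with h
    · have : (Icc (b (k + 1)) (b (k + 2))).filter (fun t => k = 0 ∨ c k < t) =
          (Icc (b (k + 1)) (b (k + 2))).erase (b (k + 1)) := by
        ext t
        simp only [mem_filter, mem_Icc, mem_erase]
        omega
      rw [this, ← add_sum_erase _ _ (left_mem_Icc.mpr hle)]
      ring
    · rw [filter_true_of_mem]
      · ring
      · intro t ht
        rw [mem_Icc] at ht
        omega

theorem shiftPow_mem_supported {s : Set ℕ} {i : ℕ} (hi : i ∈ s) (t : ℤ) :
    (shiftPow mn i t : MvPolynomial ℕ R) ∈ supported R s :=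
  have hX : (X i : MvPolynomial ℕ R) ∈ supported R s := Algebra.subset_adjoin ⟨i, hi, rfl⟩
  pow_mem (add_mem (one_mem _) hX) _

theorem C_mem_supported (s : Set ℕ) (r : R) : (C r : MvPolynomial ℕ R) ∈ supported R s :=
  Subalgebra.algebraMap_mem _ r

theorem rowSumBelow_mem_supported (k : ℕ) (t : ℤ) :
    rowSumBelow u v mn b k t ∈ supported R (Set.Iic k) := by
  refine sum_mem fun c _ => ?_
  split_ifs
  · refine prod_mem fun i hi => mul_mem (C_mem_supported _ _) (shiftPow_mem_supported _ ?_ _)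
    exact (mem_Icc.mp hi).2
  · exact zero_mem _

end Rows

section Branching

theorem rename_shiftPow {R : Type*} [CommRing R] (mn : ℤ) (σ : ℕ → ℕ) (i : ℕ) (t : ℤ) :
    rename σ (shiftPow mn i t : MvPolynomial ℕ R) = shiftPow mn (σ i) t := by
  simp [shiftPow]

variable {R : Type*} [CommRing R] (u v : R) (mn : ℤ) (b : ℕ → ℤ)

theorem rowSumLast_zero (t : ℤ) : rowSumLast u v mn b 0 t = 0 := by
  simp [rowSumLast]

theorem rowSum_zero : rowSum u v mn b 0 = 1 := by
  simp [rowSum, interlacingRows, rowTerm]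

theorem rowSumLast_eq_zero {k : ℕ} {t : ℤ} (h : b (k + 1) < t) :
    rowSumLast u v mn b k t = 0 := by
  refine sum_eq_zero fun c hc => if_neg ?_
  rintro ⟨hk, hck⟩
  have := ((mem_interlacingRows.mp hc).1 k (Nat.one_le_iff_ne_zero.mpr hk) le_rfl).2
  omega

theorem entryTerm_one (i : ℕ) (t : ℤ) : entryTerm (1 : R) 1 mn b i t = shiftPow mn i t := by
  simp [entryTerm, entryWeight]

/-- The alternating sum of the products of the first `j` lower terms and the remaining upper
terms. -/
noncomputable def boundarySum (k : ℕ) : MvPolynomial ℕ R :=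
  ∑ j ∈ range (k + 1), (-1) ^ j * ((∏ i ∈ Icc 1 j, lowerTerm v mn b i) *
    ∏ i ∈ Icc (j + 1) k, upperTerm u mn b i)

theorem boundarySum_succ (k : ℕ) :
    boundarySum u v mn b (k + 1) = boundarySum u v mn b k * upperTerm u mn b (k + 1) +
      (-1) ^ (k + 1) * ∏ i ∈ Icc 1 (k + 1), lowerTerm v mn b i := by
  rw [boundarySum, sum_range_succ, boundarySum, sum_mul]
  refine congrArg₂ (· + ·) ?_ ?_
  · refine sum_congr rfl fun j hj => ?_
    rw [mem_range] at hj
    rw [prod_Icc_succ_top (by omega : j + 1 ≤ k + 1)]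
    ring
  · simp

theorem boundarySum_add_two (k : ℕ) :
    boundarySum u v mn b (k + 2) =
      boundarySum u v mn b (k + 1) * (upperTerm u mn b (k + 2) - lowerTerm v mn b (k + 2)) +
      boundarySum u v mn b k * (upperTerm u mn b (k + 1) * lowerTerm v mn b (k + 2)) := by
  have h1 := boundarySum_succ u v mn b k
  have h2 := boundarySum_succ u v mn b (k + 1)
  rw [prod_Icc_succ_top (by omega)] at h2
  linear_combination h2 + h1 * lowerTerm v mn b (k + 2)

theorem upperTerm_mem_supported {s : Set ℕ} {i : ℕ} (hi : i ∈ s) :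
    upperTerm u mn b i ∈ supported R s :=
  have hX : (X i : MvPolynomial ℕ R) ∈ supported R s := Algebra.subset_adjoin ⟨i, hi, rfl⟩
  mul_mem (shiftPow_mem_supported mn hi _)
    (add_mem (one_mem _) (mul_mem (C_mem_supported s _) hX))

theorem lowerTerm_mem_supported {s : Set ℕ} {i : ℕ} (hi : i ∈ s) :
    lowerTerm v mn b i ∈ supported R s :=
  have hX : (X i : MvPolynomial ℕ R) ∈ supported R s := Algebra.subset_adjoin ⟨i, hi, rfl⟩
  mul_mem (shiftPow_mem_supported mn hi _)
    (add_mem (one_mem _) (mul_mem (C_mem_supported s _) hX))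

theorem boundarySum_mem_supported (k : ℕ) :
    boundarySum u v mn b k ∈ supported R (Set.Iic k) := by
  refine sum_mem fun j hj => mul_mem (pow_mem (neg_mem (one_mem _)) _)
    (mul_mem (prod_mem fun i hi => ?_) (prod_mem fun i hi => ?_))
  all_goals rw [mem_Icc] at hi; rw [mem_range] at hj
  · exact lowerTerm_mem_supported v mn b (Set.mem_Iic.mpr (by omega))
  · exact upperTerm_mem_supported u mn b (Set.mem_Iic.mpr hi.2)

/-- The product of two equal consecutive entries, multiplied by their variables. -/
noncomputable def repeatTerm (k : ℕ) : MvPolynomial ℕ R :=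
  C (u * v) * (X (k + 1) * shiftPow mn (k + 1) (b (k + 2))) *
    (X (k + 2) * shiftPow mn (k + 2) (b (k + 2)))

/-- The row sum, multiplied by the variables `x_1, …, x_k`. -/
noncomputable def rowSumMulX (k : ℕ) : MvPolynomial ℕ R :=
  (∏ i ∈ Icc 1 k, X i) * rowSum u v mn b k

theorem repeatTerm_mem_supported (k : ℕ) : repeatTerm u v mn b k ∈ supported R (Set.Ioi k) := by
  have hX : ∀ i, k < i → (X i : MvPolynomial ℕ R) ∈ supported R (Set.Ioi k) :=
    fun i hi => Algebra.subset_adjoin ⟨i, hi, rfl⟩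
  have hs : ∀ i, k < i → ∀ t, (shiftPow mn i t : MvPolynomial ℕ R) ∈ supported R (Set.Ioi k) :=
    fun i hi t => shiftPow_mem_supported mn (Set.mem_Ioi.mpr hi) t
  exact mul_mem (mul_mem (C_mem_supported _ _) (mul_mem (hX _ (by omega)) (hs _ (by omega) _)))
    (mul_mem (hX _ (by omega)) (hs _ (by omega) _))

variable {u v mn b} {n : ℕ} {e : Fin n → ℕ}

theorem mem_negligible_of_le {k : ℕ} {p : MvPolynomial ℕ R}
    (h : k ≤ n → p ∈ negligible u v e k) : p ∈ negligible u v e k :=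
  fun hk => h hk hk

theorem boundarySum_mul_mem_negligible [IsDomain R] [CharZero R] (k : ℕ) :
    boundarySum u v mn b k * (upperTerm u mn b (k + 1) * lowerTerm v mn b (k + 2) +
      repeatTerm u v mn b k) ∈ negligible u v e (k + 2) := by
  have key : upperTerm u mn b (k + 1) * lowerTerm v mn b (k + 2) + repeatTerm u v mn b k =
      shiftPow mn (k + 1) (b (k + 2)) * shiftPow mn (k + 2) (b (k + 2)) *
        pairFactor u v (k + 2) (k + 1) := by
    simp only [upperTerm, lowerTerm, repeatTerm, pairFactor, C_sub, C_1, C_mul]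
    ring
  refine mem_negligible_of_swap (by omega : 1 ≤ k + 1) ?_
  rw [key]
  simp only [map_mul, rename_shiftPow, rename_pairFactor, Equiv.swap_apply_left,
    show k + 2 = k + 1 + 1 from rfl, Equiv.swap_apply_right]
  rw [rename_eq_self_of_mem_supported (boundarySum_mem_supported u v mn b k)]
  · ring
  · intro i hi
    rw [Set.mem_Iic] at hi
    exact Equiv.swap_apply_of_ne_of_ne (by omega) (by omega)

theorem rowSumMulX_recurrence [IsDomain R] [CharZero R]
    (hmn : ∀ i, 1 ≤ i → i ≤ n → mn ≤ b i)
    (hb : ∀ i, 1 ≤ i → i ≤ n → b i < b (i + 1) ∨ b i = b (i + 1) ∧ u = 1 ∧ v = 1) (k : ℕ) :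
    rowSumMulX u v mn b (k + 2) -
      (rowSumMulX u v mn b (k + 1) * (upperTerm u mn b (k + 2) - lowerTerm v mn b (k + 2)) -
        rowSumMulX u v mn b k * repeatTerm u v mn b k) ∈ negligible u v e (k + 2) := by
  refine mem_negligible_of_le fun hk => ?_
  have hle : ∀ i, 1 ≤ i → i ≤ n → b i ≤ b (i + 1) := fun i h1 h2 => by
    rcases hb i h1 h2 with h | h <;> omega
  have hb1 := hb (k + 1) (by omega) (by omega)
  have hb2 := hb (k + 2) (by omega) hk
  have hle1 : b (k + 1) ≤ b (k + 2) := hle (k + 1) (by omega) (by omega)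
  have hle2 : b (k + 2) ≤ b (k + 3) := hle (k + 2) (by omega) hk
  have hrep : repeatTerm u v mn b k = X (k + 1) * X (k + 2) *
      entryTerm u v mn b (k + 1) (b (k + 2)) * entryTerm u v mn b (k + 2) (b (k + 2)) := by
    have hw : entryWeight u v b (k + 1) (b (k + 2)) * entryWeight u v b (k + 2) (b (k + 2)) =
        u * v := by
      simp only [entryWeight, show k + 1 + 1 = k + 2 from rfl, show k + 2 + 1 = k + 3 from rfl,
        if_true] at hb1 hb2 ⊢
      rcases hb1 with h1 | ⟨h1, rfl, rfl⟩
      · rcases hb2 with h2 | ⟨h2, rfl, rfl⟩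
        · rw [if_neg h1.ne', if_neg h2.ne]; ring
        · simp
      · simp
    rw [repeatTerm, entryTerm, entryTerm, ← hw, C_mul]
    ring
  have hsum := X_mul_sum_entryTerm u v mn b (hmn (k + 2) (by omega) hk) hb2
  have h1 := rowSum_succ u v mn b (k := k + 1) hle2
  have h2 := rowSumLast_succ u v mn b hle1 le_rfl
  rw [rowSumBelow_eq u v mn b (fun _ => hle1)] at h2
  have heq : rowSumMulX u v mn b (k + 2) -
      (rowSumMulX u v mn b (k + 1) * (upperTerm u mn b (k + 2) - lowerTerm v mn b (k + 2)) -
        rowSumMulX u v mn b k * repeatTerm u v mn b k) =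
      (∏ i ∈ Icc 1 k, X i) * rowSumLast u v mn b k (b (k + 2)) * repeatTerm u v mn b k := by
    rw [rowSumMulX, rowSumMulX, rowSumMulX, prod_Icc_succ_top (by omega),
      prod_Icc_succ_top (by omega), hrep, ← hsum]
    simp only [show k + 1 + 1 = k + 2 from rfl, show k + 1 + 2 = k + 3 from rfl] at h1 ⊢
    rw [h1, h2]
    ring
  rw [heq]
  rcases k with _ | j
  · rw [rowSumLast_zero, mul_zero, zero_mul]
    exact zero_mem _
  rcases hb1 with hlt | ⟨hbeq, rfl, rfl⟩
  · rw [rowSumLast_eq_zero u v mn b hlt, mul_zero, zero_mul]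
    exact zero_mem _
  have hle0 : b (j + 1) ≤ b (j + 2) := hle (j + 1) (by omega) (by omega)
  set t := b (j + 1 + 2) with ht
  have hbeq' : b (j + 2) = t := hbeq
  have hprod : (∏ i ∈ Icc 1 (j + 1), X i) * rowSumLast 1 1 mn b (j + 1) t *
      repeatTerm (1 : R) 1 mn b (j + 1) = ((∏ i ∈ Icc 1 j, X i) * rowSumBelow 1 1 mn b j t) *
        ((X (j + 1) * shiftPow mn (j + 1) t) * (X (j + 2) * shiftPow mn (j + 2) t) *
          (X (j + 3) * shiftPow mn (j + 3) t)) := by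
    rw [rowSumLast_succ _ _ _ _ (hbeq' ▸ hle0) hbeq'.ge, entryTerm_one,
      prod_Icc_succ_top (by omega), repeatTerm, ← ht, one_mul, C_1]
    simp only [show j + 1 + 1 = j + 2 from rfl, show j + 1 + 2 = j + 3 from rfl]
    ring
  rw [hprod]
  have hsupp : (∏ i ∈ Icc 1 j, X i) * rowSumBelow (1 : R) 1 mn b j t ∈
      supported R (Set.Iic j) :=
    mul_mem (prod_mem fun i hi => Algebra.subset_adjoin ⟨i, (mem_Icc.mp hi).2, rfl⟩)
      (rowSumBelow_mem_supported _ _ _ _ _ _)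
  have hne : Equiv.swap (j + 1) (j + 2) (j + 3) = j + 3 :=
    Equiv.swap_apply_of_ne_of_ne (by omega) (by omega)
  have hne' : Equiv.swap (j + 2) (j + 3) (j + 1) = j + 1 :=
    Equiv.swap_apply_of_ne_of_ne (by omega) (by omega)
  refine mem_negligible_of_swap_of_swap (by omega : 1 ≤ j + 1) ?_ ?_
  · rw [map_mul, rename_eq_self_of_mem_supported hsupp]
    · simp only [map_mul, rename_shiftPow, rename_X, show j + 1 + 1 = j + 2 from rfl,
        Equiv.swap_apply_left, Equiv.swap_apply_right, hne]
      ring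
    · intro i hi
      rw [Set.mem_Iic] at hi
      exact Equiv.swap_apply_of_ne_of_ne (by omega) (by omega)
  · rw [map_mul, rename_eq_self_of_mem_supported hsupp]
    · simp only [map_mul, rename_shiftPow, rename_X, show j + 1 + 1 = j + 2 from rfl,
        show j + 1 + 2 = j + 3 from rfl, Equiv.swap_apply_left, Equiv.swap_apply_right, hne']
      ring
    · intro i hi
      rw [Set.mem_Iic] at hi
      exact Equiv.swap_apply_of_ne_of_ne (by omega) (by omega)

theorem rowSumMulX_sub_boundarySum_mem [IsDomain R] [CharZero R]
    (hmn : ∀ i, 1 ≤ i → i ≤ n → mn ≤ b i)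
    (hb : ∀ i, 1 ≤ i → i ≤ n → b i < b (i + 1) ∨ b i = b (i + 1) ∧ u = 1 ∧ v = 1) (k : ℕ) :
    rowSumMulX u v mn b k - boundarySum u v mn b k ∈ negligible u v e k := by
  induction k using Nat.twoStepInduction with
  | zero =>
    have : rowSumMulX u v mn b 0 - boundarySum u v mn b 0 = 0 := by
      simp [rowSumMulX, boundarySum, rowSum_zero]
    rw [this]
    exact zero_mem _
  | one =>
    refine mem_negligible_of_le fun hn => ?_
    have hb1 : b 1 < b 2 ∨ b 1 = b 2 ∧ u = 1 ∧ v = 1 := hb 1 le_rfl hn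
    have hle : b 1 ≤ b 2 := by rcases hb1 with h | h <;> omega
    have h1 := rowSum_succ u v mn b (k := 0) hle
    have h2 := X_mul_sum_entryTerm u v mn b (hmn 1 le_rfl hn) (hb 1 le_rfl hn)
    rw [rowSumLast_zero, rowSum_zero, one_mul, zero_mul, sub_zero] at h1
    have : rowSumMulX u v mn b 1 - boundarySum u v mn b 1 = 0 := by
      rw [boundarySum_succ, boundarySum, rowSumMulX, h1]
      simp only [zero_add, Icc_self, prod_singleton, h2]
      simp only [zero_add, range_one, sum_singleton, pow_zero, pow_one, one_mul]
      simp
      ring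
    rw [this]
    exact zero_mem _
  | more k ih0 ih1 =>
    have h3 := rowSumMulX_recurrence (e := e) hmn hb k
    have h4 := boundarySum_mul_mem_negligible (u := u) (v := v) (mn := mn) (b := b) (e := e) k
    have h5 := mul_mem_negligible (Nat.le_succ (k + 1)) ih1
      (sub_mem (upperTerm_mem_supported u mn b (Set.mem_Ioi.mpr (Nat.lt_succ_self (k + 1))))
        (lowerTerm_mem_supported v mn b (Set.mem_Ioi.mpr (Nat.lt_succ_self (k + 1)))))
    have h6 := mul_mem_negligible (by omega : k ≤ k + 2) ih0 (repeatTerm_mem_supported u v mn b k)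
    convert sub_mem (sub_mem (add_mem h3 h5) h6) h4 using 1
    rw [boundarySum_add_two]
    ring

theorem altCoeff_boundarySum [IsDomain R] [CharZero R]
    (hmn : ∀ i, 1 ≤ i → i ≤ n → mn ≤ b i)
    (hb : ∀ i, 1 ≤ i → i ≤ n → b i < b (i + 1) ∨ b i = b (i + 1) ∧ u = 1 ∧ v = 1) :
    altCoeff n e (boundarySum u v mn b n * pairProd u v n) =
      altCoeff n e (rowSumMulX u v mn b n * pairProd u v n) := by
  have h := rowSumMulX_sub_boundarySum_mem (e := e) hmn hb n le_rfl 1 (one_mem _)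
  rw [mul_one, sub_mul, map_sub, sub_eq_zero] at h
  exact h.symm

end Branching

section BranchingRule

/-- The increasing enumeration of the natural numbers other than `k + 1`. -/
def skipIndex (k i : ℕ) : ℕ := if i ≤ k then i else i + 1

theorem prod_Icc_skipIndex {M : Type*} [CommMonoid M] {k n : ℕ} (hk : k ≤ n) (g : ℕ → M) :
    ∏ i ∈ Icc 1 n, g (skipIndex k i) =
      (∏ i ∈ Icc 1 k, g i) * ∏ i ∈ Icc (k + 1) n, g (i + 1) := by
  induction n, hk using Nat.le_induction with
  | base =>
    rw [Icc_eq_empty (by omega : ¬k + 1 ≤ k), prod_empty, mul_one]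
    exact prod_congr rfl fun i hi => by rw [skipIndex, if_pos (mem_Icc.mp hi).2]
  | succ n hn ih =>
    rw [prod_Icc_succ_top (by omega), prod_Icc_succ_top (by omega : k + 1 ≤ n + 1), ih, mul_assoc,
      skipIndex, if_neg (by omega)]

theorem prod_Icc_eq_mul_skipIndex {M : Type*} [CommMonoid M] {k n : ℕ} (hk : k ≤ n)
    (g : ℕ → M) :
    ∏ i ∈ Icc 1 (n + 1), g i = g (k + 1) * ∏ i ∈ Icc 1 n, g (skipIndex k i) := by
  rw [prod_Icc_skipIndex hk]
  induction n, hk using Nat.le_induction with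
  | base =>
    rw [Icc_eq_empty (by omega : ¬k + 1 ≤ k), prod_empty, mul_one, prod_Icc_succ_top (by omega),
      mul_comm]
  | succ n hn ih =>
    rw [prod_Icc_succ_top (by omega), prod_Icc_succ_top (by omega : k + 1 ≤ n + 1), ih]
    simp only [mul_assoc]

theorem prod_ltPairs_succ {M : Type*} [CommMonoid M] (n : ℕ) (f : ℕ → ℕ → M) :
    ∏ p ∈ ltPairs (n + 1), f p.1 p.2 =
      (∏ p ∈ ltPairs n, f p.1 p.2) * ∏ i ∈ Icc 1 n, f i (n + 1) := by
  rw [← prod_filter_mul_prod_filter_not (ltPairs (n + 1)) (fun p => p.2 ≤ n)]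
  congr 1
  · refine prod_congr ?_ fun _ _ => rfl
    ext p
    simp only [mem_filter, mem_ltPairs]
    omega
  · refine prod_nbij' (fun p => p.1) (fun i => (i, n + 1)) ?_ ?_ ?_ ?_ ?_
    · intro p hp
      simp only [mem_filter, mem_ltPairs] at hp
      rw [mem_Icc]
      omega
    · intro i hi
      simp only [mem_filter, mem_ltPairs]
      rw [mem_Icc] at hi
      omega
    · intro p hp
      simp only [mem_filter, mem_ltPairs] at hp
      exact Prod.ext rfl (by dsimp only; omega)
    · intro i _
      rfl
    · intro p hp
      simp only [mem_filter, mem_ltPairs] at hp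
      rw [show p.2 = n + 1 by omega]

theorem prod_ltPairs_skipIndex {M : Type*} [CommMonoid M] {k n : ℕ} (hk : k ≤ n)
    (f : ℕ → ℕ → M) :
    ∏ p ∈ ltPairs (n + 1), f p.1 p.2 =
      (∏ p ∈ ltPairs n, f (skipIndex k p.1) (skipIndex k p.2)) *
        ((∏ i ∈ Icc 1 k, f i (k + 1)) * ∏ i ∈ Icc (k + 1) n, f (k + 1) (i + 1)) := by
  induction n, hk using Nat.le_induction with
  | base =>
    rw [Icc_eq_empty (by omega : ¬k + 1 ≤ k), prod_empty, mul_one, prod_ltPairs_succ]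
    congr 1
    refine prod_congr rfl fun p hp => ?_
    rw [mem_ltPairs] at hp
    rw [skipIndex, skipIndex, if_pos (by omega), if_pos (by omega)]
  | succ n hn ih =>
    rw [prod_ltPairs_succ (n + 1), ih,
      prod_ltPairs_succ n (fun i j => f (skipIndex k i) (skipIndex k j)),
      prod_Icc_eq_mul_skipIndex hn, prod_Icc_succ_top (by omega : k + 1 ≤ n + 1)]
    have : skipIndex k (n + 1) = n + 1 + 1 := by rw [skipIndex, if_neg (by omega)]
    simp only [this]
    ac_rfl

variable {R : Type*} [CommRing R] (u v : R) (mn : ℤ) (b : ℕ → ℤ)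

theorem delVar_X_skipIndex (k i : ℕ) :
    delVar (k + 1) (X (skipIndex k i) : MvPolynomial ℕ R) = X i := by
  rw [delVar, aeval_X, skipIndex]
  split_ifs <;> first | rfl | omega

theorem delVar_X_of_le {k i : ℕ} (h : i ≤ k) :
    delVar (k + 1) (X i : MvPolynomial ℕ R) = X i := by
  rw [delVar, aeval_X, if_pos (by omega)]

theorem delVar_X_add_one_of_lt {k i : ℕ} (h : k < i) :
    delVar (k + 1) (X (i + 1) : MvPolynomial ℕ R) = X i := by
  rw [delVar, aeval_X, if_neg (by omega), if_neg (by omega), Nat.add_sub_cancel]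

theorem delVar_X_self (k : ℕ) : delVar k (X k : MvPolynomial ℕ R) = 0 := by
  rw [delVar, aeval_X, if_neg (lt_irrefl k), if_pos rfl]

/-- The polynomial whose alternating coefficients count triangles with bottom row `b`. -/
noncomputable def rowPoly (n : ℕ) : MvPolynomial ℕ R :=
  (∏ i ∈ Icc 1 n, shiftPow mn i (b i)) * pairProd u v n

theorem delVar_rowPoly {k n : ℕ} (hk : k ≤ n) :
    delVar (k + 1) (rowPoly u v mn b (n + 1)) =
      ((∏ i ∈ Icc 1 k, lowerTerm v mn b i) * ∏ i ∈ Icc (k + 1) n, upperTerm u mn b i) *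
        pairProd u v n := by
  have hC : ∀ r : R, delVar (k + 1) (C r : MvPolynomial ℕ R) = C r := fun r =>
    (delVar (k + 1) : MvPolynomial ℕ R →ₐ[R] MvPolynomial ℕ R).commutes r
  have h1 : ∏ i ∈ Icc 1 n, delVar (k + 1) (shiftPow mn (skipIndex k i) (b (skipIndex k i))) =
      ((∏ i ∈ Icc 1 k, shiftPow mn i (b i)) *
        ∏ i ∈ Icc (k + 1) n, shiftPow mn i (b (i + 1)) : MvPolynomial ℕ R) := by
    rw [prod_Icc_skipIndex hk (fun i => delVar (k + 1) (shiftPow mn i (b i)))]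
    congr 1 <;> refine prod_congr rfl fun i hi => ?_ <;> rw [mem_Icc] at hi
    · rw [shiftPow, map_pow, map_add, map_one, delVar_X_of_le hi.2]
    · rw [shiftPow, map_pow, map_add, map_one, delVar_X_add_one_of_lt (by omega), shiftPow]
  have h2 : delVar (k + 1) (shiftPow mn (k + 1) (b (k + 1)) : MvPolynomial ℕ R) = 1 := by
    rw [shiftPow, map_pow, map_add, map_one, delVar_X_self, add_zero, one_pow]
  have h3 : ∏ i ∈ Icc 1 k, delVar (k + 1) (pairFactor u v i (k + 1)) =
      ∏ i ∈ Icc 1 k, (1 + C (1 - v) * X i) := by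
    refine prod_congr rfl fun i hi => ?_
    rw [mem_Icc] at hi
    simp only [pairFactor, map_add, map_mul, map_one, hC, delVar_X_self, delVar_X_of_le hi.2]
    ring
  have h4 : ∏ i ∈ Icc (k + 1) n, delVar (k + 1) (pairFactor u v (k + 1) (i + 1)) =
      ∏ i ∈ Icc (k + 1) n, (1 + C u * X i) := by
    refine prod_congr rfl fun i hi => ?_
    rw [mem_Icc] at hi
    simp only [pairFactor, map_add, map_mul, map_one, hC, delVar_X_self,
      delVar_X_add_one_of_lt (show k < i by omega)]
    ring
  have h5 : ∏ p ∈ ltPairs n,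
      delVar (k + 1) (pairFactor u v (skipIndex k p.1) (skipIndex k p.2)) = pairProd u v n := by
    refine prod_congr rfl fun p _ => ?_
    simp only [pairFactor, map_add, map_mul, map_one, hC, delVar_X_skipIndex]
  rw [rowPoly, pairProd, map_mul, map_prod, map_prod, prod_Icc_eq_mul_skipIndex hk,
    prod_ltPairs_skipIndex hk (fun i j => delVar (k + 1) (pairFactor u v i j)), h1, h2, h3, h4, h5]
  simp only [lowerTerm, upperTerm, prod_mul_distrib]
  ring

theorem altCoeff_rowPoly_succ [IsDomain R] [CharZero R] {n : ℕ} (hn : 1 ≤ n) (c : ℕ)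
    (hmn : ∀ i, 1 ≤ i → i ≤ n → mn ≤ b i)
    (hb : ∀ i, 1 ≤ i → i ≤ n → b i < b (i + 1) ∨ b i = b (i + 1) ∧ u = 1 ∧ v = 1) :
    altCoeff (n + 1) (rowExponent (n + 1) c) (rowPoly u v mn b (n + 1)) =
      ∑ r ∈ interlacingRows b n, (∏ i ∈ Icc 1 n, entryWeight u v b i (r i)) *
        altCoeff n (rowExponent n c) (rowPoly u v mn r n) := by
  have h0 : rowExponent (n + 1) c 0 = 0 := by
    rw [rowExponent, if_neg (by rw [Fin.val_zero]; omega), Fin.val_zero]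
  have hsucc : (fun j : Fin n => rowExponent (n + 1) c j.succ) =
      fun j => rowExponent n c j + 1 := by
    funext j
    simp only [rowExponent, Fin.val_succ]
    split_ifs <;> omega
  have hrow : ∀ r, rowTerm u v mn b n r * pairProd u v n =
      (∏ i ∈ Icc 1 n, entryWeight u v b i (r i)) • rowPoly u v mn r n := by
    intro r
    rw [rowTerm, rowPoly, smul_eq_C_mul, map_prod, ← mul_assoc, ← prod_mul_distrib]
    rfl
  have hbd : ∑ k ∈ range (n + 1), (-1) ^ k * altCoeff n (fun j => rowExponent (n + 1) c j.succ)
      (delVar (k + 1) (rowPoly u v mn b (n + 1))) =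
      altCoeff n (fun j => rowExponent (n + 1) c j.succ)
        (boundarySum u v mn b n * pairProd u v n) := by
    rw [boundarySum, sum_mul, map_sum]
    refine sum_congr rfl fun k hk => ?_
    rw [delVar_rowPoly u v mn b (Nat.lt_succ_iff.mp (mem_range.mp hk)), ← smul_eq_mul,
      ← LinearMap.map_smul, smul_eq_C_mul, map_pow, map_neg, map_one]
    simp only [mul_assoc]
  rw [altCoeff_succ _ h0, hbd, altCoeff_boundarySum hmn hb, hsucc, rowSumMulX, mul_assoc,
    altCoeff_prod_X_mul, rowSum, sum_mul, map_sum]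
  refine sum_congr rfl fun r _ => ?_
  rw [hrow, LinearMap.map_smul, smul_eq_mul]

end BranchingRule

section Triangles

open Classical in
/-- The monotone triangles of order `n` with bottom row `b`. -/
noncomputable def monotoneTriangles : ℕ → (ℕ → ℤ) → Finset (ℕ → ℕ → ℤ)
  | 0, _ => {0}
  | n + 1, b => (interlacingRows b n).biUnion fun c => (monotoneTriangles n c).image fun M =>
      Function.update M (n + 1) fun j => if 1 ≤ j ∧ j ≤ n + 1 then b j else 0

theorem mem_monotoneTriangles {n : ℕ} {b : ℕ → ℤ} {M : ℕ → ℕ → ℤ} :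
    M ∈ monotoneTriangles n b ↔ IsMT n M ∧ ∀ j ∈ Icc 1 n, M n j = b j := by
  classical
  induction n generalizing b M with
  | zero =>
    rw [monotoneTriangles, mem_singleton]
    constructor
    · rintro rfl
      exact ⟨⟨fun i j _ _ h => by omega, fun i j _ _ h => by omega, fun i j _ => rfl⟩,
        fun j hj => by rw [mem_Icc] at hj; omega⟩
    · rintro ⟨⟨-, -, h⟩, -⟩
      funext i j
      exact h i j (by omega)
  | succ n ih =>
    simp only [monotoneTriangles, mem_biUnion, mem_image]
    constructor
    · rintro ⟨c, hc, M, hM, rfl⟩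
      obtain ⟨⟨h1, h2, h3⟩, h4⟩ := ih.mp hM
      obtain ⟨hc1, hc2, hc3⟩ := mem_interlacingRows.mp hc
      have hrow : ∀ j, 1 ≤ j → j ≤ n → M n j = c j := fun j hj hj' =>
        h4 j (mem_Icc.mpr ⟨hj, hj'⟩)
      refine ⟨⟨fun i j hj hji hi => ?_, fun i j hj hji hi => ?_, fun i j hij => ?_⟩,
        fun j hj => ?_⟩
      · rw [Function.update_of_ne (by omega : i ≠ n + 1)]
        rcases eq_or_ne i n with rfl | hne
        · rw [Function.update_self, if_pos (by omega), if_pos (by omega), hrow j hj hji]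
          exact hc1 j hj hji
        · rw [Function.update_of_ne (by omega : i + 1 ≠ n + 1)]
          exact h1 i j hj hji (by omega)
      · rw [Function.update_of_ne (by omega : i ≠ n + 1)]
        rcases eq_or_ne i n with rfl | hne
        · rw [hrow j hj (by omega), hrow (j + 1) (by omega) (by omega)]
          exact hc2 j hj hji
        · exact h2 i j hj hji (by omega)
      · rcases eq_or_ne i (n + 1) with rfl | hne
        · rw [Function.update_self, if_neg (by omega)]
        · rw [Function.update_of_ne hne]
          exact h3 i j (by omega)
      · rw [mem_Icc] at hj
        rw [Function.update_self, if_pos hj]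
    · rintro ⟨⟨h1, h2, h3⟩, h4⟩
      have hrow : ∀ j, 1 ≤ j → j ≤ n + 1 → M (n + 1) j = b j := fun j hj hj' =>
        h4 j (mem_Icc.mpr ⟨hj, hj'⟩)
      refine ⟨M n, mem_interlacingRows.mpr ⟨fun i hi hi' => ?_, fun i hi hi' => ?_,
        fun i hi => ?_⟩, Function.update M (n + 1) 0, ih.mpr ⟨⟨fun i j hj hji hi => ?_,
        fun i j hj hji hi => ?_, fun i j hij => ?_⟩, fun j hj => ?_⟩, ?_⟩
      · rw [← hrow i hi (by omega), ← hrow (i + 1) (by omega) (by omega)]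
        exact h1 n i hi hi' (by omega)
      · exact h2 n i hi hi' (by omega)
      · exact h3 n i (by omega)
      · rw [Function.update_of_ne (by omega : i ≠ n + 1),
          Function.update_of_ne (by omega : i + 1 ≠ n + 1)]
        exact h1 i j hj hji (by omega)
      · rw [Function.update_of_ne (by omega : i ≠ n + 1)]
        exact h2 i j hj hji (by omega)
      · rcases eq_or_ne i (n + 1) with rfl | hne
        · rw [Function.update_self, Pi.zero_apply]
        · rw [Function.update_of_ne hne]
          exact h3 i j (by omega)
      · rw [Function.update_of_ne (by omega : n ≠ n + 1)]
      · rw [Function.update_idem, Function.update_eq_self_iff]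
        funext j
        split_ifs with h
        · exact (hrow j h.1 h.2).symm
        · exact (h3 (n + 1) j (by omega)).symm

theorem sum_monotoneTriangles_succ {A : Type*} [AddCommMonoid A] (n : ℕ) (b : ℕ → ℤ)
    (f : (ℕ → ℕ → ℤ) → A) :
    ∑ M ∈ monotoneTriangles (n + 1) b, f M =
      ∑ c ∈ interlacingRows b n, ∑ M ∈ monotoneTriangles n c,
        f (Function.update M (n + 1) fun j => if 1 ≤ j ∧ j ≤ n + 1 then b j else 0) := by
  classical
  rw [monotoneTriangles, sum_biUnion]
  · refine sum_congr rfl fun c _ => sum_image fun M hM M' hM' h => ?_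
    funext i j
    rcases eq_or_ne i (n + 1) with rfl | hi
    · rw [(mem_monotoneTriangles.mp hM).1.2.2 _ _ (by omega),
        (mem_monotoneTriangles.mp hM').1.2.2 _ _ (by omega)]
    · simpa [hi] using congrFun₂ h i j
  · intro c hc c' hc' hne
    rw [Function.onFun, disjoint_left]
    rintro d hd hd'
    obtain ⟨M, hM, rfl⟩ := mem_image.mp hd
    obtain ⟨M', hM', h⟩ := mem_image.mp hd'
    refine hne (funext fun j => ?_)
    by_cases hj : 1 ≤ j ∧ j ≤ n
    · rw [← (mem_monotoneTriangles.mp hM).2 j (mem_Icc.mpr hj),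
        ← (mem_monotoneTriangles.mp hM').2 j (mem_Icc.mpr hj)]
      simpa using (congrFun₂ h n j).symm
    · rw [(mem_interlacingRows.mp hc).2.2 j hj, (mem_interlacingRows.mp hc').2.2 j hj]

theorem card_filter_triangle_succ (n : ℕ) (P : ℕ → ℕ → Prop) [∀ i j, Decidable (P i j)] :
    ((Icc 1 (n + 1) ×ˢ Icc 1 (n + 1)).filter
        fun p => p.2 ≤ p.1 ∧ p.1 < n + 1 ∧ P p.1 p.2).card =
      ((Icc 1 n ×ˢ Icc 1 n).filter fun p => p.2 ≤ p.1 ∧ p.1 < n ∧ P p.1 p.2).card +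
        ((Icc 1 n).filter (P n)).card := by
  rw [← card_filter_add_card_filter_not (fun p : ℕ × ℕ => p.1 < n), filter_filter]
  congr 1
  · congr 1
    ext p
    simp only [mem_filter, mem_product, mem_Icc]
    constructor
    · rintro ⟨h, ⟨h1, h2, h3⟩, h4⟩
      exact ⟨by omega, h1, h4, h3⟩
    · rintro ⟨h, h1, h2, h3⟩
      exact ⟨by omega, ⟨h1, by omega, h3⟩, h2⟩
  · refine card_nbij' (fun p => p.2) (fun j => (n, j)) ?_ ?_ ?_ ?_
    · rintro ⟨i, j⟩ hp
      simp only [coe_filter, Set.mem_ofPred_eq, mem_filter, mem_product, mem_Icc] at hp ⊢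
      obtain ⟨⟨h, h1, h2, h3⟩, h4⟩ := hp
      obtain rfl : i = n := by omega
      exact ⟨by omega, h3⟩
    · intro j hj
      simp only [coe_filter, Set.mem_ofPred_eq, mem_filter, mem_product, mem_Icc] at hj ⊢
      exact ⟨⟨by omega, hj.1.2, by omega, hj.2⟩, by omega⟩
    · rintro ⟨i, j⟩ hp
      simp only [coe_filter, Set.mem_ofPred_eq, mem_filter, mem_product, mem_Icc] at hp
      exact Prod.ext (by dsimp only; omega) rfl
    · intro j _
      rfl

variable {R : Type*} [CommRing R] (u v : R) (mn : ℤ)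

theorem weight_update {n : ℕ} {b c : ℕ → ℤ} {M : ℕ → ℕ → ℤ} (hM : M ∈ monotoneTriangles n c) :
    u ^ invMT (n + 1)
        (Function.update M (n + 1) fun j => if 1 ≤ j ∧ j ≤ n + 1 then b j else 0) *
      v ^ invMT' (n + 1)
        (Function.update M (n + 1) fun j => if 1 ≤ j ∧ j ≤ n + 1 then b j else 0) =
      (∏ i ∈ Icc 1 n, entryWeight u v b i (c i)) * (u ^ invMT n M * v ^ invMT' n M) := by
  set M' := Function.update M (n + 1) fun j => if 1 ≤ j ∧ j ≤ n + 1 then b j else 0 with hM'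
  have hlow : ∀ i j, i ≤ n → M' i j = M i j := fun i j hi => by
    rw [hM', Function.update_of_ne (by omega)]
  have htop : ∀ j, 1 ≤ j → j ≤ n + 1 → M' (n + 1) j = b j := fun j hj hj' => by
    rw [hM', Function.update_self, if_pos ⟨hj, hj'⟩]
  have hrow : ∀ j, 1 ≤ j → j ≤ n → M' n j = c j := fun j hj hj' => by
    rw [hlow n j le_rfl]
    exact (mem_monotoneTriangles.mp hM).2 j (mem_Icc.mpr ⟨hj, hj'⟩)
  have h1 : invMT (n + 1) M' =
      invMT n M + ((Icc 1 n).filter fun j => c j = b (j + 1)).card := by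
    rw [invMT, card_filter_triangle_succ n (fun i j => M' i j = M' (i + 1) (j + 1)), invMT]
    congr 2
    · refine filter_congr fun p _ => and_congr_right fun _ => and_congr_right fun h => ?_
      rw [hlow _ _ h.le, hlow _ _ h]
    · refine filter_congr fun j hj => ?_
      rw [mem_Icc] at hj
      rw [hrow j hj.1 hj.2, htop (j + 1) (by omega) (by omega)]
  have h2 : invMT' (n + 1) M' =
      invMT' n M + ((Icc 1 n).filter fun j => c j = b j).card := by
    rw [invMT', card_filter_triangle_succ n (fun i j => M' i j = M' (i + 1) j), invMT']
    congr 2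
    · refine filter_congr fun p _ => and_congr_right fun _ => and_congr_right fun h => ?_
      rw [hlow _ _ h.le, hlow _ _ h]
    · refine filter_congr fun j hj => ?_
      rw [mem_Icc] at hj
      rw [hrow j hj.1 hj.2, htop j hj.1 (by omega)]
  rw [h1, h2, pow_add, pow_add]
  simp only [entryWeight, prod_mul_distrib, ← prod_filter, prod_const]
  ring

theorem altCoeff_one_rowPoly (b : ℕ → ℤ) (c : ℕ) :
    altCoeff 1 (rowExponent 1 c) (rowPoly u v mn b 1) = ((b 1 - mn).toNat.choose c : R) := by
  have hpairs : pairProd u v 1 = 1 := by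
    refine prod_eq_one fun p hp => ?_
    rw [mem_ltPairs] at hp
    omega
  rw [rowPoly, hpairs, mul_one, Icc_self, prod_singleton, shiftPow, add_comm, add_pow, map_sum]
  have hterm : ∀ m, altCoeff 1 (rowExponent 1 c)
      (X 1 ^ m * 1 ^ ((b 1 - mn).toNat - m) * ((b 1 - mn).toNat.choose m : MvPolynomial ℕ R)) =
      if m = c then ((b 1 - mn).toNat.choose m : R) else 0 := by
    intro m
    have : (X 1 ^ m * 1 ^ ((b 1 - mn).toNat - m) *
        ((b 1 - mn).toNat.choose m : MvPolynomial ℕ R)) =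
        monomial (Finsupp.single 1 m) ((b 1 - mn).toNat.choose m : R) := by
      rw [one_pow, mul_one, ← map_natCast (C : R →+* MvPolynomial ℕ R), mul_comm,
        C_mul_X_pow_eq_monomial]
    rw [this, altCoeff_monomial, Matrix.det_unique]
    simp [rowExponent]
  simp only [hterm, sum_ite_eq', mem_range]
  split_ifs with h
  · rfl
  · rw [Nat.choose_eq_zero_of_lt (by omega), Nat.cast_zero]

theorem altCoeff_rowPoly [IsDomain R] [CharZero R] (c : ℕ) {n : ℕ} (hn : 1 ≤ n) :
    ∀ {b : ℕ → ℤ}, (∀ i, 1 ≤ i → i ≤ n → mn ≤ b i) →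
      (∀ i, 1 ≤ i → i < n → b i < b (i + 1) ∨ b i = b (i + 1) ∧ u = 1 ∧ v = 1) →
      altCoeff n (rowExponent n c) (rowPoly u v mn b n) = ∑ M ∈ monotoneTriangles n b,
        u ^ invMT n M * v ^ invMT' n M * ((M 1 1 - mn).toNat.choose c : R) := by
  induction n, hn using Nat.le_induction with
  | base =>
    intro b _ _
    rw [altCoeff_one_rowPoly, sum_monotoneTriangles_succ]
    simp only [interlacingRows, monotoneTriangles, sum_singleton]
    rw [weight_update u v (c := 0) (by rw [monotoneTriangles, mem_singleton])]
    simp [invMT, invMT']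
  | succ n hn ih =>
    intro b hmn hb
    rw [altCoeff_rowPoly_succ u v mn b hn c (fun i h h' => hmn i h (by omega))
      (fun i h h' => hb i h (by omega)), sum_monotoneTriangles_succ]
    refine sum_congr rfl fun r hr => ?_
    obtain ⟨hr1, hr2, -⟩ := mem_interlacingRows.mp hr
    rw [ih (fun i h h' => (hmn i h (by omega)).trans (hr1 i h h').1)
      (fun i h h' => Or.inl (hr2 i h h')), mul_sum]
    refine sum_congr rfl fun M hM => ?_
    rw [weight_update u v hM, Function.update_of_ne (by omega : 1 ≠ n + 1)]
    ring

theorem IsMT.top_bounds {n : ℕ} {M : ℕ → ℕ → ℤ} (h : IsMT n M) (hn : 1 ≤ n) :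
    M n 1 ≤ M 1 1 ∧ M 1 1 ≤ M n n := by
  have key : ∀ i, 1 ≤ i → i ≤ n → M i 1 ≤ M 1 1 ∧ M 1 1 ≤ M i i := by
    intro i hi
    induction i, hi using Nat.le_induction with
    | base => exact fun _ => ⟨le_rfl, le_rfl⟩
    | succ i hi ih =>
      intro hin
      have := ih (by omega)
      exact ⟨(h.1 i 1 le_rfl hi (by omega)).1.trans this.1,
        this.2.trans (h.1 i i hi le_rfl (by omega)).2⟩
  exact key n hn le_rfl

end Triangles

section ConstantTerm

theorem sum_sign_mul_choose_mul_choose {N A B : ℕ} (hB : B ≤ N) :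
    ∑ c ∈ range (N + 1), (-1 : ℤ) ^ (A + c) * (c.choose A : ℤ) * (B.choose c : ℤ) =
      if B = A then 1 else 0 := by
  rcases lt_or_ge B A with h | h
  · rw [if_neg h.ne]
    refine sum_eq_zero fun c _ => ?_
    rcases lt_or_ge c A with hc | hc
    · rw [Nat.choose_eq_zero_of_lt hc]; simp
    · rw [Nat.choose_eq_zero_of_lt (h.trans_le hc)]; simp
  · obtain ⟨d, rfl⟩ := Nat.exists_eq_add_of_le h
    obtain ⟨r, rfl⟩ := Nat.exists_eq_add_of_le hB
    rw [show A + d + r + 1 = A + (d + 1) + r by ring, sum_range_add, sum_range_add,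
      sum_eq_zero, zero_add, sum_eq_zero (s := range r), add_zero]
    · have hterm : ∀ k ∈ range (d + 1), (-1 : ℤ) ^ (A + (A + k)) * ((A + k).choose A : ℤ) *
          ((A + d).choose (A + k) : ℤ) = (A + d).choose A * ((-1) ^ k * d.choose k) := by
        intro k _
        have := Nat.choose_mul (n := A + d) (k := A + k) (s := A) (by omega)
        rw [Nat.add_sub_cancel_left, Nat.add_sub_cancel_left] at this
        zify at this
        rw [← add_assoc, pow_add, Even.neg_one_pow ⟨A, rfl⟩]
        linear_combination (-1) ^ k * this
      rw [sum_congr rfl hterm, ← mul_sum, Int.alternating_sum_range_choose]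
      simp only [Nat.add_eq_left]
      split_ifs with hd
      · simp [hd]
      · rw [mul_zero]
    · intro k _
      rw [Nat.choose_eq_zero_of_lt (by omega : A + d < A + (d + 1) + k)]
      simp
    · intro k hk
      rw [Nat.choose_eq_zero_of_lt (mem_range.mp hk)]
      simp

theorem units_neg_one_zpow_cast {a mn : ℤ} (h : mn ≤ a) (c : ℕ) :
    (((-1 : ℤˣ) ^ (a + mn + (c : ℤ)) : ℤˣ) : ℤ) = (-1) ^ ((a - mn).toNat + c) := by
  have : a + mn + (c : ℤ) = 2 * mn + (((a - mn).toNat + c : ℕ) : ℤ) := by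
    push_cast
    omega
  rw [this, zpow_add, zpow_mul, zpow_natCast]
  simp

variable {R : Type*} [CommRing R] (u v : R)

theorem coeff_sum_eq_altCoeff (mn : ℤ) {n : ℕ} (hn : 1 ≤ n) (b : ℕ → ℤ) (c : ℕ) :
    ∑ d ∈ Nat.antidiagonalTuple n c, coeff (ctdeg2 n d)
      ((∏ i ∈ Icc 1 n, (1 + X i) ^ (b i - mn).toNat) *
        ∏ p ∈ ltPairs n, ((X p.1 - X p.2) * pairFactor u v p.1 p.2)) =
      altCoeff n (rowExponent n c) (rowPoly u v mn b n) := by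
  have hX : ∀ i ∈ Set.Icc 1 n, (X i : MvPolynomial ℕ R) ∈ supported R (Set.Icc 1 n) :=
    fun i hi => Algebra.subset_adjoin ⟨i, hi, rfl⟩
  rw [← sum_coeff_ctdeg2 hn]
  · refine sum_congr rfl fun d _ => ?_
    rw [prod_mul_distrib, mul_comm (∏ p ∈ ltPairs n, (X p.1 - X p.2)), ← mul_assoc]
    rfl
  · refine mul_mem (prod_mem fun i hi => shiftPow_mem_supported mn (mem_Icc.mp hi) _)
      (prod_mem fun p hp => ?_)
    rw [mem_ltPairs] at hp
    have h1 := hX p.1 ⟨by omega, by omega⟩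
    have h2 := hX p.2 ⟨by omega, by omega⟩
    exact add_mem (add_mem (one_mem _) (mul_mem (C_mem_supported _ _) h1))
      (mul_mem (C_mem_supported _ _) (add_mem h2 (mul_mem h1 h2)))

theorem sum_filter_monotoneTriangles [IsDomain R] [CharZero R] {n : ℕ} (hn : 1 ≤ n)
    {mn mx a : ℤ} {b : ℕ → ℤ} (hmn : mn ≤ 0) (hb0 : 0 ≤ b 1) (hbn : b n ≤ mx) (hamn : mn ≤ a)
    (hb : ∀ i, 1 ≤ i → i < n → b i < b (i + 1) ∨ b i = b (i + 1) ∧ u = 1 ∧ v = 1) :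
    ∑ M ∈ monotoneTriangles n b with M 1 1 = a, u ^ invMT n M * v ^ invMT' n M =
      ∑ c ∈ range ((mx - mn).toNat + 1),
        ((((-1 : ℤˣ) ^ (a + mn + (c : ℤ)) : ℤˣ) : ℤ) : R) * (c.choose (a - mn).toNat : R) *
          ∑ d ∈ Nat.antidiagonalTuple n c, coeff (ctdeg2 n d)
            ((∏ i ∈ Icc 1 n, (1 + X i) ^ (b i - mn).toNat) *
              ∏ p ∈ ltPairs n, ((X p.1 - X p.2) * pairFactor u v p.1 p.2)) := by
  have hbmn : ∀ i, 1 ≤ i → i ≤ n → mn ≤ b i := by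
    intro i hi
    induction i, hi using Nat.le_induction with
    | base => exact fun _ => hmn.trans hb0
    | succ i hi ih =>
      intro hin
      have := ih (by omega)
      rcases hb i hi (by omega) with h | h <;> omega
  simp only [coeff_sum_eq_altCoeff u v mn hn, altCoeff_rowPoly u v mn _ hn hbmn hb, mul_sum,
    units_neg_one_zpow_cast hamn]
  rw [sum_comm, sum_filter]
  refine sum_congr rfl fun M hM => ?_
  obtain ⟨hMT, hrow⟩ := mem_monotoneTriangles.mp hM
  have hbounds := hMT.top_bounds hn
  rw [hrow 1 (mem_Icc.mpr ⟨le_rfl, hn⟩), hrow n (mem_Icc.mpr ⟨hn, le_rfl⟩)] at hbounds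
  have key := congrArg (Int.cast : ℤ → R) (sum_sign_mul_choose_mul_choose
    (N := (mx - mn).toNat) (A := (a - mn).toNat) (B := (M 1 1 - mn).toNat) (by omega))
  have hiff : (M 1 1 - mn).toNat = (a - mn).toNat ↔ M 1 1 = a := by omega
  simp only [hiff] at key
  push_cast at key
  have : ∀ c, ((((-1 : ℤ) ^ ((a - mn).toNat + c) : ℤ) : R) * (c.choose (a - mn).toNat : R) *
      (u ^ invMT n M * v ^ invMT' n M * ((M 1 1 - mn).toNat.choose c : R))) =
      u ^ invMT n M * v ^ invMT' n M * ((-1) ^ ((a - mn).toNat + c) *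
        (c.choose (a - mn).toNat : R) * ((M 1 1 - mn).toNat.choose c : R)) := by
    intro c
    push_cast
    ring
  simp only [this]
  rw [← mul_sum, key, mul_ite, mul_one, mul_zero]

theorem coe_filter_monotoneTriangles (n : ℕ) (b : ℕ → ℤ) (a : ℤ) :
    {M : ℕ → ℕ → ℤ | IsMT n M ∧ (∀ j ∈ Icc 1 n, M n j = b j) ∧ M 1 1 = a} =
      ((monotoneTriangles n b).filter fun M => M 1 1 = a : Finset (ℕ → ℕ → ℤ)) := by
  ext M
  rw [coe_filter, Set.mem_ofPred_eq, Set.mem_ofPred_eq, mem_monotoneTriangles, and_assoc]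

end ConstantTerm

end MonotoneTriangleCount

/-- Monotone triangles with prescribed bottom row and prescribed top entry `a`:
the generating function w.r.t. the two inversion numbers equals the constant term of the
Laurent polynomial of Corollary `stmt1` multiplied by
`Σ_{b=0}^{max−min} (−1)^{a+min+b} C(b,a−min) ∏ (1+x_i)^{−min} h_b(x_1^{−1},…,x_n^{−1})`;
note `h_b(x⁻¹) = Σ_{|d|=b} ∏ x_i^{−d_i}`.  For `u = v = 1` weak increase of the bottom row
suffices. -/
theorem stmt2 (n : ℕ) (hn : 1 ≤ n) (mn mx a : ℤ) (b : ℕ → ℤ)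
    (hmn : mn ≤ 0) (hb0 : 0 ≤ b 1) (hbn : b n ≤ mx) (hamn : mn ≤ a) (hamx : a ≤ mx) :
    ((∀ i, 1 ≤ i → i < n → b i < b (i+1)) →
      (∑ᶠ M ∈ {M : ℕ → ℕ → ℤ |
          IsMT n M ∧ (∀ j ∈ Finset.Icc 1 n, M n j = b j) ∧ M 1 1 = a},
          Uv ^ invMT n M * Vv ^ invMT' n M) =
      ∑ c ∈ Finset.range ((mx - mn).toNat + 1),
        ((((-1 : ℤˣ) ^ (a + mn + (c : ℤ)) : ℤˣ) : ℤ) : S2) * (c.choose (a - mn).toNat : S2) *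
          ∑ d ∈ Finset.Nat.antidiagonalTuple n c,
            MvPolynomial.coeff (ctdeg2 n d)
              ((∏ i ∈ Finset.Icc 1 n, (1 + MvPolynomial.X i) ^ (b i - mn).toNat) *
                ∏ p ∈ (Finset.Icc 1 n ×ˢ Finset.Icc 1 n).filter (fun p => p.1 < p.2),
                  ((MvPolynomial.X p.1 - MvPolynomial.X p.2) *
                    (1 + MvPolynomial.C (1 - Vv) * MvPolynomial.X p.1 +
                      MvPolynomial.C Uv *
                        (MvPolynomial.X p.2 + MvPolynomial.X p.1 * MvPolynomial.X p.2)) :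
                    MvPolynomial ℕ S2))) ∧
    ((∀ i, 1 ≤ i → i < n → b i ≤ b (i+1)) →
      (Set.ncard {M : ℕ → ℕ → ℤ |
          IsMT n M ∧ (∀ j ∈ Finset.Icc 1 n, M n j = b j) ∧ M 1 1 = a} : ℚ) =
      ∑ c ∈ Finset.range ((mx - mn).toNat + 1),
        ((((-1 : ℤˣ) ^ (a + mn + (c : ℤ)) : ℤˣ) : ℤ) : ℚ) * (c.choose (a - mn).toNat : ℚ) *
          ∑ d ∈ Finset.Nat.antidiagonalTuple n c,
            MvPolynomial.coeff (ctdeg2 n d)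
              ((∏ i ∈ Finset.Icc 1 n, (1 + MvPolynomial.X i) ^ (b i - mn).toNat) *
                ∏ p ∈ (Finset.Icc 1 n ×ˢ Finset.Icc 1 n).filter (fun p => p.1 < p.2),
                  ((MvPolynomial.X p.1 - MvPolynomial.X p.2) *
                    (1 + MvPolynomial.X p.2 + MvPolynomial.X p.1 * MvPolynomial.X p.2) :
                    MvPolynomial ℕ ℚ))) := by
  refine ⟨fun hb => ?_, fun hb => ?_⟩
  · rw [coe_filter_monotoneTriangles, finsum_mem_coe_finset]
    exact sum_filter_monotoneTriangles Uv Vv hn hmn hb0 hbn hamn fun i h h' => Or.inl (hb i h h')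
  · rw [coe_filter_monotoneTriangles, Set.ncard_coe_finset]
    have h := sum_filter_monotoneTriangles (1 : ℚ) 1 hn hmn hb0 hbn hamn fun i h h' =>
      (hb i h h').lt_or_eq.imp_right fun h => ⟨h, rfl, rfl⟩
    simpa only [one_pow, mul_one, Finset.sum_const, nsmul_eq_mul, ltPairs, pairFactor, sub_self,
      MvPolynomial.C_0, MvPolynomial.C_1, zero_mul, add_zero, one_mul, ← add_assoc] using h
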